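/- arXiv:2409.01336 — 9 statements merged into one kernel-verified Lean document; each statement's English description precedes it below -/
import Mathlib

section
/- Let G be a finite simple undirected graph on n vertices with adjacency matrix A, let τ > 0, and set M = τ·A + I. If x is a solution of the Lotka–Volterra system with initial condition x(0) ∈ [0,1]ⁿ, then x(t) ∈ [0,1]ⁿ for all t ≥ 0. -/
open Matrix

/-- `x : ℝ → ℝⁿ` is a solution of the Lotka–Volterra system with interaction matrix `M`:
for every `t` and every `i`, `xᵢ'(t) = xᵢ(t)·(1 − (M·x(t))ᵢ)`. -/
def IsLVSol {n : ℕ} (M : Matrix (Fin n) (Fin n) ℝ) (x : ℝ → Fin n → ℝ) : Prop :=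
  ∀ t : ℝ, ∀ i : Fin n, HasDerivAt (fun s => x s i) (x t i * (1 - M.mulVec (x t) i)) t

/-- A linear differential inequality `w' ≥ a w` preserves nonnegativity forward in time. -/
theorem lv_nonneg_aux (w w' a : ℝ → ℝ) (ha : Continuous a)
    (hw : ∀ t, HasDerivAt w (w' t) t) (hge : ∀ t, 0 ≤ t → a t * w t ≤ w' t)
    (h0 : 0 ≤ w 0) : ∀ t, 0 ≤ t → 0 ≤ w t := by
  intro t ht
  have hI : ∀ s, HasDerivAt (fun u => ∫ r in (0:ℝ)..u, a r) (a s) s := fun s =>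
    intervalIntegral.integral_hasDerivAt_right (ha.intervalIntegrable _ _)
      ha.stronglyMeasurable.stronglyMeasurableAtFilter ha.continuousAt
  have hF : ∀ s, HasDerivAt (fun u => w u * Real.exp (-∫ r in (0:ℝ)..u, a r))
      (w' s * Real.exp (-∫ r in (0:ℝ)..s, a r)
        + w s * (Real.exp (-∫ r in (0:ℝ)..s, a r) * (-a s))) s := fun s =>
    (hw s).mul (hI s).neg.exp
  have hmono : MonotoneOn (fun u => w u * Real.exp (-∫ r in (0:ℝ)..u, a r)) (Set.Ici 0) := by
    apply monotoneOn_of_deriv_nonneg (convex_Ici 0)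
    · exact fun s _ => (hF s).continuousAt.continuousWithinAt
    · exact fun s _ => (hF s).differentiableAt.differentiableWithinAt
    · intro s hs
      rw [interior_Ici] at hs
      rw [(hF s).deriv]
      have h1 := hge s (le_of_lt hs)
      have h2 := Real.exp_pos (-∫ r in (0:ℝ)..s, a r)
      nlinarith [mul_nonneg (sub_nonneg.2 h1) h2.le]
  have h3 := hmono (Set.mem_Ici.2 le_rfl) (Set.mem_Ici.2 ht) ht
  simp only [intervalIntegral.integral_same, neg_zero, Real.exp_zero, mul_one] at h3
  exact nonneg_of_mul_nonneg_left (h0.trans h3) (Real.exp_pos _)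

theorem lv_invariant_unit_cube {n : ℕ}
    (A : Matrix (Fin n) (Fin n) ℝ)
    (hAsymm : A.IsSymm) (hA01 : ∀ i j, A i j = 0 ∨ A i j = 1) (hAdiag : ∀ i, A i i = 0)
    (τ : ℝ) (hτ : 0 < τ)
    (x : ℝ → Fin n → ℝ) (hx : IsLVSol (τ • A + 1) x)
    (hx0 : ∀ i, x 0 i ∈ Set.Icc (0:ℝ) 1) :
    ∀ t : ℝ, 0 ≤ t → ∀ i, x t i ∈ Set.Icc (0:ℝ) 1 := by
  have hc : ∀ i, Continuous (fun s => x s i) := fun i =>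
    continuous_iff_continuousAt.2 fun t => (hx t i).continuousAt
  have hcx : Continuous x := continuous_pi hc
  have hg : ∀ i, Continuous (fun t => 1 - (τ • A + 1).mulVec (x t) i) := by
    intro i
    have h : Continuous (fun t => (τ • A + 1).mulVec (x t)) :=
      Continuous.matrix_mulVec continuous_const hcx
    exact continuous_const.sub ((continuous_apply i).comp h)
  have hnn : ∀ i, ∀ t, 0 ≤ t → 0 ≤ x t i := fun i =>
    lv_nonneg_aux _ _ _ (hg i) (fun t => hx t i)
      (fun t _ => le_of_eq (mul_comm _ _)) (hx0 i).1
  have hup : ∀ i, ∀ t, 0 ≤ t → 0 ≤ 1 - x t i := by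
    intro i
    refine lv_nonneg_aux (fun t => 1 - x t i) _ (fun t => - x t i) (hc i).neg
      (fun t => (hx t i).const_sub 1) ?_ (sub_nonneg.2 (hx0 i).2)
    intro t ht
    have h1 : 0 ≤ A.mulVec (x t) i := by
      simp only [Matrix.mulVec, dotProduct]
      refine Finset.sum_nonneg fun j _ => mul_nonneg ?_ (hnn j t ht)
      rcases hA01 i j with h | h <;> simp [h]
    have h2 : (τ • A + 1).mulVec (x t) i = τ * A.mulVec (x t) i + x t i := by
      simp [Matrix.add_mulVec, Matrix.smul_mulVec]
    rw [h2]
    nlinarith [mul_nonneg (hnn i t ht) (mul_nonneg hτ.le h1)]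
  exact fun t ht i => ⟨hnn i t ht, sub_nonneg.1 (hup i t ht)⟩
end

section
/- Let G be a finite simple undirected graph on n vertices with adjacency matrix A, let τ > 0, and set M = τ·A + I. Every solution x of the Lotka–Volterra system defined for all t ≥ 0 with x(0) ∈ [0,1]ⁿ converges as t → ∞ to a single equilibrium point, i.e., the limit x* = lim_{t→∞} x(t) exists and satisfies x*_i·(1 − (M·x*)_i) = 0 for every i. -/
open Matrix Filter Topology

/-- gradient term `g = 1 - M x` -/
noncomputable def lvG {n : ℕ} (M : Matrix (Fin n) (Fin n) ℝ) (x : Fin n → ℝ) (i : Fin n) : ℝ :=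
  1 - M.mulVec x i

/-- the potential -/
noncomputable def lvV {n : ℕ} (M : Matrix (Fin n) (Fin n) ℝ) (x : Fin n → ℝ) : ℝ :=
  ∑ i, x i - (1/2) * ∑ i, x i * M.mulVec x i

/-- the dissipation -/
noncomputable def lvD {n : ℕ} (M : Matrix (Fin n) (Fin n) ℝ) (x : Fin n → ℝ) : ℝ :=
  ∑ i, x i * (lvG M x i)^2

lemma lv_symm_sum {n : ℕ} (M : Matrix (Fin n) (Fin n) ℝ) (hM : M.IsSymm) (x y : Fin n → ℝ) :
    ∑ i, x i * M.mulVec y i = ∑ i, y i * M.mulVec x i := by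
  change x ⬝ᵥ M.mulVec y = y ⬝ᵥ M.mulVec x
  rw [Matrix.dotProduct_mulVec, ← Matrix.mulVec_transpose, hM.eq, dotProduct_comm]

lemma lvV_sub {n : ℕ} (M : Matrix (Fin n) (Fin n) ℝ) (hM : M.IsSymm) (x q : Fin n → ℝ) :
    lvV M x - lvV M q = (1/2) * ∑ i, (x i - q i) * (lvG M q i + lvG M x i) := by
  have h := lv_symm_sum M hM x q
  have e : ∑ i, (x i - q i) * (lvG M q i + lvG M x i)
      = 2 * ∑ i, x i - 2 * ∑ i, q i - ∑ i, x i * M.mulVec q i - ∑ i, x i * M.mulVec x i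
        + ∑ i, q i * M.mulVec q i + ∑ i, q i * M.mulVec x i := by
    simp only [Finset.mul_sum, ← Finset.sum_sub_distrib, ← Finset.sum_add_distrib, lvG]
    exact Finset.sum_congr rfl fun i _ => by ring
  rw [e, h]; unfold lvV; ring

/-- the linear map of a face -/
noncomputable def lvL {n : ℕ} (M : Matrix (Fin n) (Fin n) ℝ) (Z : Finset (Fin n)) :
    (Fin n → ℝ) →ₗ[ℝ] (Fin n → ℝ) :=
  LinearMap.pi fun i => if i ∈ Z then LinearMap.proj i else (LinearMap.proj i).comp M.mulVecLin

lemma lvL_apply {n : ℕ} (M : Matrix (Fin n) (Fin n) ℝ) (Z : Finset (Fin n)) (x : Fin n → ℝ)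
    (i : Fin n) : lvL M Z x i = if i ∈ Z then x i else M.mulVec x i := by
  unfold lvL; split_ifs with h <;> simp [h]

lemma lin_bound {n : ℕ} (L : (Fin n → ℝ) →ₗ[ℝ] (Fin n → ℝ)) :
    ∃ C : ℝ, 0 ≤ C ∧ ∀ y, ∃ k, L k = L y ∧ ‖k‖ ≤ C * ‖L y‖ := by
  obtain ⟨R, hR⟩ := L.rangeRestrict.exists_rightInverse_of_surjective L.range_rangeRestrict
  let R' := LinearMap.toContinuousLinearMap R
  refine ⟨‖R'‖, ContinuousLinearMap.opNorm_nonneg R', fun y => ⟨R (L.rangeRestrict y), ?_, ?_⟩⟩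
  · have := congrArg (fun f => (f (L.rangeRestrict y) : Fin n → ℝ)) hR
    simpa using this
  · exact R'.le_opNorm (L.rangeRestrict y)

lemma lin_gap {n : ℕ} (L : (Fin n → ℝ) →ₗ[ℝ] (Fin n → ℝ)) (b : Fin n → ℝ)
    (hb : ∀ q, L q ≠ b) : ∃ c : ℝ, 0 < c ∧ ∀ x, c ≤ ‖L x - b‖ := by
  have hc : IsClosed (LinearMap.range L : Set (Fin n → ℝ)) := Submodule.closed_of_finiteDimensional _
  have hn : b ∉ (LinearMap.range L : Set (Fin n → ℝ)) := by
    rintro ⟨q, hq⟩; exact hb q hq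
  refine ⟨Metric.infDist b (LinearMap.range L : Set (Fin n → ℝ)),
    (hc.notMem_iff_infDist_pos ⟨0, Submodule.zero_mem _⟩).1 hn, fun x => ?_⟩
  rw [← dist_eq_norm, dist_comm]
  exact Metric.infDist_le_dist_of_mem ⟨x, rfl⟩

/-- Lojasiewicz on one face -/
lemma face_est {n : ℕ} (M : Matrix (Fin n) (Fin n) ℝ) (hM : M.IsSymm) (Z : Finset (Fin n)) :
    (∃ c : ℝ, 0 < c ∧ ∀ (x : Fin n → ℝ) (s : ℝ), 0 ≤ s → (∀ i ∈ Z, |x i| ≤ s) →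
        (∀ i ∉ Z, |lvG M x i| ≤ s) → c ≤ s) ∨
    (∃ v C : ℝ, 0 < C ∧ ∀ (x : Fin n → ℝ) (s : ℝ), 0 ≤ s → (∀ i ∈ Z, |x i| ≤ s) →
        (∀ i ∈ Z, |x i * lvG M x i| ≤ s^2) →
        (∀ i ∉ Z, |lvG M x i| ≤ s) → |lvV M x - v| ≤ C * s^2) := by
  set b : Fin n → ℝ := fun i => if i ∈ Z then 0 else 1 with hbdef
  have key : ∀ (x : Fin n → ℝ) (s : ℝ), 0 ≤ s → (∀ i ∈ Z, |x i| ≤ s) →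
        (∀ i ∉ Z, |lvG M x i| ≤ s) → ‖lvL M Z x - b‖ ≤ s := by
    intro x s hs h1 h2
    rw [pi_norm_le_iff_of_nonneg hs]
    intro i
    rw [Pi.sub_apply, lvL_apply, Real.norm_eq_abs]
    by_cases hi : i ∈ Z
    · simpa [b, hi] using h1 i hi
    · have := h2 i hi
      rw [lvG, abs_sub_comm] at this
      simpa [b, hi] using this
  by_cases hb : ∀ q, lvL M Z q ≠ b
  · left
    obtain ⟨c, hc, h⟩ := lin_gap _ b hb
    exact ⟨c, hc, fun x s hs h1 h2 => (h x).trans (key x s hs h1 h2)⟩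
  · right
    push Not at hb
    obtain ⟨p, hp⟩ := hb
    obtain ⟨C, hC, hR⟩ := lin_bound (lvL M Z)
    have sol : ∀ q, lvL M Z q = b → (∀ i ∈ Z, q i = 0) ∧ (∀ i ∉ Z, lvG M q i = 0) := by
      intro q hq
      refine ⟨fun i hi => ?_, fun i hi => ?_⟩
      · have := congrFun hq i
        rw [lvL_apply] at this; simpa [b, hi] using this
      · have := congrFun hq i
        rw [lvL_apply] at this
        simp only [b, hi, if_false] at this
        rw [lvG, this, sub_self]
    have hVeq : ∀ q, lvL M Z q = b → lvV M q = lvV M p := by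
      intro q hq
      rw [← sub_eq_zero, lvV_sub M hM, Finset.sum_eq_zero, mul_zero]
      intro i _
      by_cases hi : i ∈ Z
      · rw [(sol q hq).1 i hi, (sol p hp).1 i hi]; ring
      · rw [(sol q hq).2 i hi, (sol p hp).2 i hi]; ring
    let Mc := LinearMap.toContinuousLinearMap M.mulVecLin
    have hK : 0 ≤ ‖Mc‖ := norm_nonneg _
    refine ⟨lvV M p, (1/2) * (n * (C + 2 + ‖Mc‖ * C)) + 1, by positivity, ?_⟩
    intro x s hs h1 h1' h2
    obtain ⟨k, hk1, hk2⟩ := hR (x - p)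
    have hLk : lvL M Z k = lvL M Z x - b := by rw [hk1, map_sub, hp]
    have hkn : ‖k‖ ≤ C * s := by
      refine hk2.trans ?_
      rw [map_sub, hp]
      exact mul_le_mul_of_nonneg_left (key x s hs h1 h2) hC
    have hq : lvL M Z (x - k) = b := by rw [map_sub, hLk]; abel
    obtain ⟨q0, r0⟩ := sol _ hq
    rw [← hVeq _ hq, lvV_sub M hM, abs_mul, abs_of_pos (by norm_num : (0:ℝ) < 1/2)]
    have hMk : ∀ i, |M.mulVec k i| ≤ ‖Mc‖ * (C * s) := by
      intro i
      calc |M.mulVec k i| ≤ ‖Mc k‖ := norm_le_pi_norm (M.mulVec k) i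
        _ ≤ ‖Mc‖ * ‖k‖ := Mc.le_opNorm k
        _ ≤ _ := mul_le_mul_of_nonneg_left hkn hK
    have hki : ∀ i, |k i| ≤ C * s := fun i => (norm_le_pi_norm k i).trans hkn
    have term : ∀ i, |(x i - (x - k) i) * (lvG M (x - k) i + lvG M x i)|
        ≤ (C + 2 + ‖Mc‖ * C) * s^2 := by
      intro i
      have hxk : x i - (x - k) i = k i := by simp
      rw [hxk]
      have hs2 : 0 ≤ s^2 := sq_nonneg s
      have hKC : 0 ≤ ‖Mc‖ * C := mul_nonneg hK hC
      by_cases hi : i ∈ Z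
      · have hkx : k i = x i := by
          have := q0 i hi
          simp at this; linarith
        have hr : lvG M (x - k) i = lvG M x i + M.mulVec k i := by
          simp [lvG, Matrix.mulVec_sub]; ring
        rw [hkx, hr]
        have e : x i * (lvG M x i + M.mulVec k i + lvG M x i)
          = 2 * (x i * lvG M x i) + x i * M.mulVec k i := by ring
        rw [e]
        refine (abs_add_le _ _).trans ?_
        rw [abs_mul 2, abs_mul (x i) (M.mulVec k i), abs_two]
        have a1 := h1' i hi
        have a2 : |x i| * |M.mulVec k i| ≤ s * (‖Mc‖ * (C * s)) :=
          mul_le_mul (h1 i hi) (hMk i) (abs_nonneg _) hs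
        nlinarith [mul_nonneg hC hs2]
      · rw [r0 i hi, zero_add, abs_mul]
        have a2 : |k i| * |lvG M x i| ≤ (C * s) * s :=
          mul_le_mul (hki i) (h2 i hi) (abs_nonneg _) (mul_nonneg hC hs)
        nlinarith [mul_nonneg hKC hs2]
    have hsum : |∑ i, (x i - (x - k) i) * (lvG M (x - k) i + lvG M x i)|
        ≤ n * ((C + 2 + ‖Mc‖ * C) * s^2) := by
      refine (Finset.abs_sum_le_sum_abs _ _).trans ?_
      refine (Finset.sum_le_sum fun i _ => term i).trans ?_
      simp
    nlinarith [sq_nonneg s]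

lemma lvD_nonneg {n : ℕ} (M : Matrix (Fin n) (Fin n) ℝ) (x : Fin n → ℝ) (h : ∀ i, 0 ≤ x i) :
    0 ≤ lvD M x := Finset.sum_nonneg fun i _ => mul_nonneg (h i) (sq_nonneg _)

lemma lvD_term {n : ℕ} (M : Matrix (Fin n) (Fin n) ℝ) (x : Fin n → ℝ) (h : ∀ i, 0 ≤ x i)
    (i : Fin n) : x i * (lvG M x i)^2 ≤ lvD M x :=
  Finset.single_le_sum (f := fun i => x i * (lvG M x i)^2)
    (fun i _ => mul_nonneg (h i) (sq_nonneg _)) (Finset.mem_univ i)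

/-- nonnegativity via integrating factor -/
lemma comparison (y f : ℝ → ℝ) (y' : ℝ → ℝ) (hf : Continuous f)
    (hy : ∀ t, HasDerivAt y (y' t) t) (h0 : 0 ≤ y 0)
    (hle : ∀ t, 0 ≤ t → f t * y t ≤ y' t) : ∀ t, 0 ≤ t → 0 ≤ y t := by
  let F : ℝ → ℝ := fun t => ∫ s in (0:ℝ)..t, f s
  have hF : ∀ t, HasDerivAt F (f t) t := fun t =>
    intervalIntegral.integral_hasDerivAt_right (hf.intervalIntegrable _ _)
      hf.aestronglyMeasurable.stronglyMeasurableAtFilter hf.continuousAt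
  have hz : ∀ t, HasDerivAt (fun t => y t * Real.exp (-F t))
      (y' t * Real.exp (-F t) + y t * (Real.exp (-F t) * (-f t))) t := fun t =>
    (hy t).mul ((hF t).neg.exp)
  have hm : MonotoneOn (fun t => y t * Real.exp (-F t)) (Set.Ici 0) := by
    apply monotoneOn_of_hasDerivWithinAt_nonneg (convex_Ici 0)
      (fun t _ => (hz t).continuousAt.continuousWithinAt)
      (fun t _ => (hz t).hasDerivWithinAt)
    intro t ht
    rw [interior_Ici] at ht
    have := hle t (le_of_lt ht)
    have e := Real.exp_pos (-F t)
    nlinarith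
  intro t ht
  have h := hm (Set.mem_Ici.2 le_rfl) (Set.mem_Ici.2 ht) ht
  have : 0 ≤ y t * Real.exp (-F t) := le_trans (mul_nonneg h0 (Real.exp_pos _).le) h
  exact nonneg_of_mul_nonneg_left this (Real.exp_pos _)

lemma lvV_deriv {n : ℕ} (M : Matrix (Fin n) (Fin n) ℝ) (hM : M.IsSymm) (x : ℝ → Fin n → ℝ)
    (hx : IsLVSol M x) (t : ℝ) : HasDerivAt (fun t => lvV M (x t)) (lvD M (x t)) t := by
  set x' : Fin n → ℝ := fun i => x t i * (1 - M.mulVec (x t) i) with hx'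
  have hd : ∀ i, HasDerivAt (fun s => x s i) (x' i) t := hx t
  have hMd : ∀ i, HasDerivAt (fun s => M.mulVec (x s) i) (M.mulVec x' i) t := by
    intro i
    simp only [Matrix.mulVec, dotProduct]
    exact HasDerivAt.fun_sum fun j _ => (hd j).const_mul _
  have h1 : HasDerivAt (fun t => lvV M (x t))
    (∑ i, x' i - (1/2) * ∑ i, (x' i * M.mulVec (x t) i + x t i * M.mulVec x' i)) t := by
    unfold lvV
    exact (HasDerivAt.fun_sum fun i _ => hd i).sub
      ((HasDerivAt.fun_sum fun i _ => (hd i).mul (hMd i)).const_mul _)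
  convert h1 using 1
  rw [Finset.sum_add_distrib, lv_symm_sum M hM (x t) x', ← two_mul, ← mul_assoc]
  norm_num
  rw [← Finset.sum_sub_distrib]
  exact Finset.sum_congr rfl fun i _ => by simp only [hx', lvG]; ring

/-- Main convergence, abstract -/
lemma lv_conv {n : ℕ} (M : Matrix (Fin n) (Fin n) ℝ) (hM : M.IsSymm) (x : ℝ → Fin n → ℝ)
    (hx : IsLVSol M x) (hb : ∀ t, 0 ≤ t → ∀ i, 0 ≤ x t i ∧ x t i ≤ 1) :
    ∃ xs : Fin n → ℝ, Tendsto x atTop (𝓝 xs) := by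
  have hV := lvV_deriv M hM x hx
  have hD0 : ∀ t, 0 ≤ t → 0 ≤ lvD M (x t) := fun t ht => lvD_nonneg M _ fun i => (hb t ht i).1
  have hmono : MonotoneOn (fun t => lvV M (x t)) (Set.Ici 0) := by
    apply monotoneOn_of_hasDerivWithinAt_nonneg (convex_Ici 0)
      (fun t _ => (hV t).continuousAt.continuousWithinAt)
      (fun t _ => (hV t).hasDerivWithinAt)
    intro t ht
    rw [interior_Ici] at ht
    exact hD0 t (le_of_lt ht)
  -- bounded
  have hbd : ∃ B, ∀ t, 0 ≤ t → lvV M (x t) ≤ B := by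
    have hc : Continuous (lvV M) := by
      unfold lvV Matrix.mulVec dotProduct; fun_prop
    have hK : IsCompact (Set.Icc (0 : Fin n → ℝ) 1) := isCompact_Icc
    obtain ⟨B, hB⟩ := (hK.image hc).bddAbove
    exact ⟨B, fun t ht => hB ⟨x t, ⟨fun i => (hb t ht i).1, fun i => (hb t ht i).2⟩, rfl⟩⟩
  have conv_of_mono : ∀ (f : ℝ → ℝ) (T B : ℝ), MonotoneOn f (Set.Ici T) →
      (∀ t, T ≤ t → f t ≤ B) → ∃ l, Tendsto f atTop (𝓝 l) ∧ ∀ t, T ≤ t → f t ≤ l := by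
    intro f T B hf hB
    let g : ℝ → ℝ := fun t => f (max T t)
    have hg : Monotone g := fun a b hab =>
      hf (Set.mem_Ici.2 (le_max_left _ _)) (Set.mem_Ici.2 (le_max_left _ _)) (max_le_max le_rfl hab)
    have hgb : BddAbove (Set.range g) := ⟨B, by rintro _ ⟨t, rfl⟩; exact hB _ (le_max_left _ _)⟩
    refine ⟨⨆ t, g t, (tendsto_atTop_ciSup hg hgb).congr' ?_, ?_⟩
    · filter_upwards [eventually_ge_atTop T] with t ht
      simp [g, max_eq_right ht]
    · intro t ht
      have := le_ciSup hgb t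
      simpa [g, max_eq_right ht] using this
  obtain ⟨B, hB⟩ := hbd
  obtain ⟨Vi, hVi, hVle⟩ := conv_of_mono _ 0 B hmono hB
  -- w with w^6 = D
  have hw : ∀ t, ∃ w : ℝ, 0 ≤ w ∧ (0 ≤ t → w^6 = lvD M (x t)) := by
    intro t
    by_cases ht : 0 ≤ t
    · refine ⟨(lvD M (x t)) ^ ((1:ℝ)/6), Real.rpow_nonneg (hD0 t ht) _, fun _ => ?_⟩
      rw [← Real.rpow_natCast, ← Real.rpow_mul (hD0 t ht)]; norm_num
    · exact ⟨0, le_rfl, fun h => absurd h ht⟩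
  choose w hw0 hw6 using hw
  -- Lojasiewicz for each face
  have hZ : ∀ Z : Finset (Fin n), ∃ C : ℝ, 0 < C ∧ ∀ᶠ t in atTop,
      Z = Finset.univ.filter (fun i => x t i ≤ (w t)^2) → Vi - lvV M (x t) ≤ C * (w t)^4 := by
    intro Z
    have facts : ∀ t, 0 ≤ t → Z = Finset.univ.filter (fun i => x t i ≤ (w t)^2) →
        (∀ i ∈ Z, |x t i| ≤ (w t)^2) ∧ (∀ i ∈ Z, |x t i * lvG M (x t) i| ≤ ((w t)^2)^2) ∧
        (∀ i ∉ Z, |lvG M (x t) i| ≤ (w t)^2) := by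
      intro t ht hZt
      have hx0 := fun i => (hb t ht i).1
      have hterm : ∀ i, x t i * (lvG M (x t) i)^2 ≤ (w t)^6 := fun i => by
        rw [hw6 t ht]; exact lvD_term M _ hx0 i
      have hmem : ∀ i, i ∈ Z ↔ x t i ≤ (w t)^2 := fun i => by rw [hZt]; simp
      refine ⟨fun i hi => ?_, fun i hi => ?_, fun i hi => ?_⟩
      · rw [abs_of_nonneg (hx0 i)]; exact (hmem i).1 hi
      · apply abs_le_of_sq_le_sq _ (by positivity)
        have h1 := (hmem i).1 hi
        have h2 := hterm i
        calc (x t i * lvG M (x t) i)^2 = x t i * (x t i * (lvG M (x t) i)^2) := by ring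
          _ ≤ (w t)^2 * (w t)^6 := mul_le_mul h1 h2
              (mul_nonneg (hx0 i) (sq_nonneg _)) (by positivity)
          _ = _ := by ring
      · have h1 : (w t)^2 < x t i := by
          by_contra h; exact hi ((hmem i).2 (not_lt.1 h))
        have h2 := hterm i
        apply abs_le_of_sq_le_sq _ (by positivity)
        have h3 : 0 < x t i := lt_of_le_of_lt (by positivity) h1
        by_contra h
        push Not at h
        have h4 : x t i * ((w t)^2)^2 < x t i * (lvG M (x t) i)^2 := mul_lt_mul_of_pos_left h h3
        have h5 : (w t)^2 * ((w t)^2)^2 ≤ x t i * ((w t)^2)^2 :=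
          mul_le_mul_of_nonneg_right h1.le (by positivity)
        nlinarith
    have big : ∀ c : ℝ, 0 < c → ∃ C : ℝ, 0 < C ∧ ∀ t, 0 ≤ t → c ≤ (w t)^4 →
        Vi - lvV M (x t) ≤ C * (w t)^4 := by
      intro c hc
      have hu0 : 0 ≤ Vi - lvV M (x 0) := sub_nonneg.2 (hVle 0 le_rfl)
      refine ⟨(Vi - lvV M (x 0) + 1) / c, by positivity, fun t ht h => ?_⟩
      have h1 : lvV M (x 0) ≤ lvV M (x t) := hmono (Set.mem_Ici.2 le_rfl) (Set.mem_Ici.2 ht) ht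
      have h2 : (Vi - lvV M (x 0) + 1) / c * c ≤ (Vi - lvV M (x 0) + 1) / c * (w t)^4 :=
        mul_le_mul_of_nonneg_left h (by positivity)
      rw [div_mul_cancel₀ _ hc.ne'] at h2
      linarith
    rcases face_est M hM Z with ⟨c, hc, hest⟩ | ⟨v, C, hC, hest⟩
    · obtain ⟨C, hC, hbig⟩ := big (c^2) (by positivity)
      refine ⟨C, hC, ?_⟩
      filter_upwards [eventually_ge_atTop 0] with t ht hZt
      obtain ⟨f1, f2, f3⟩ := facts t ht hZt
      have := hest (x t) ((w t)^2) (by positivity) f1 f3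
      exact hbig t ht (by nlinarith)
    · by_cases hv : v = Vi
      · refine ⟨C, hC, ?_⟩
        filter_upwards [eventually_ge_atTop 0] with t ht hZt
        obtain ⟨f1, f2, f3⟩ := facts t ht hZt
        have := hest (x t) ((w t)^2) (by positivity) f1 f2 f3
        rw [hv] at this
        have h2 := (abs_le.1 this).1
        nlinarith
      · have hgap : 0 < |Vi - v| := abs_pos.2 (sub_ne_zero.2 (Ne.symm hv))
        obtain ⟨C', hC', hbig⟩ := big (|Vi - v| / 2 / C) (by positivity)
        refine ⟨C', hC', ?_⟩
        have hev : ∀ᶠ t in atTop, |Vi - v| / 2 < |lvV M (x t) - v| :=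
          ((hVi.sub_const v).abs).eventually (lt_mem_nhds (half_lt_self hgap))
        filter_upwards [eventually_ge_atTop 0, hev] with t ht hg hZt
        obtain ⟨f1, f2, f3⟩ := facts t ht hZt
        have := hest (x t) ((w t)^2) (by positivity) f1 f2 f3
        apply hbig t ht
        rw [div_le_iff₀ hC]
        nlinarith
  choose C hC hCe using hZ
  obtain ⟨T0, hT0⟩ := eventually_atTop.1 (eventually_all.2 hCe)
  set T := max T0 0 with hT
  have hTnn : 0 ≤ T := le_max_right _ _
  set K := ∑ Z, C Z with hK
  have hKpos : 0 < K := Finset.sum_pos (fun Z _ => hC Z) Finset.univ_nonempty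
  have hLoj : ∀ t, T ≤ t → Vi - lvV M (x t) ≤ K * (w t)^4 := by
    intro t ht
    have h1 := hT0 t ((le_max_left _ _).trans ht) _ rfl
    refine h1.trans (mul_le_mul_of_nonneg_right ?_ (by positivity))
    exact Finset.single_le_sum (f := C) (fun Z _ => (hC Z).le) (Finset.mem_univ _)
  -- bound on x'
  have hspeed : ∀ t, 0 ≤ t → ∀ i, |x t i * (1 - M.mulVec (x t) i)| ≤ (w t)^3 := by
    intro t ht i
    have hw' := hw0 t
    apply abs_le_of_sq_le_sq _ (by positivity)
    have h1 := lvD_term M (x t) (fun i => (hb t ht i).1) i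
    rw [← hw6 t ht] at h1
    unfold lvG at h1
    have h2 := hb t ht i
    have h3 : 0 ≤ x t i * (1 - M.mulVec (x t) i)^2 := mul_nonneg h2.1 (sq_nonneg _)
    calc (x t i * (1 - M.mulVec (x t) i))^2 = x t i * (x t i * (1 - M.mulVec (x t) i)^2) := by ring
      _ ≤ 1 * (w t)^6 := mul_le_mul h2.2 h1 h3 zero_le_one
      _ = _ := by ring
  suffices hi : ∀ i, ∃ l, Tendsto (fun t => x t i) atTop (𝓝 l) by
    choose l hl using hi
    exact ⟨l, tendsto_pi_nhds.2 hl⟩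
  intro i
  by_cases hpos : ∀ t, T ≤ t → 0 < Vi - lvV M (x t)
  · -- main case
    let W : ℝ → ℝ := fun t => (Vi - lvV M (x t)) ^ ((1:ℝ)/4)
    have hWd : ∀ t, T ≤ t → HasDerivAt W
        (-(lvD M (x t)) * ((1:ℝ)/4) * (Vi - lvV M (x t)) ^ ((1:ℝ)/4 - 1)) t := fun t ht =>
      ((hV t).const_sub Vi).rpow_const (Or.inl (hpos t ht).ne')
    let c : ℝ := 4 * K ^ ((3:ℝ)/4)
    have hkey : ∀ t, T ≤ t → c *
        (-(lvD M (x t)) * ((1:ℝ)/4) * (Vi - lvV M (x t)) ^ ((1:ℝ)/4 - 1)) ≤ - (w t)^3 := by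
      intro t ht
      have hu := hpos t ht
      have hw' := hw0 t
      have hA : (Vi - lvV M (x t)) ^ ((3:ℝ)/4) ≤ K ^ ((3:ℝ)/4) * (w t)^3 := by
        calc (Vi - lvV M (x t)) ^ ((3:ℝ)/4) ≤ (K * (w t)^4) ^ ((3:ℝ)/4) :=
              Real.rpow_le_rpow hu.le (hLoj t ht) (by norm_num)
          _ = K ^ ((3:ℝ)/4) * (w t)^3 := by
              rw [Real.mul_rpow hKpos.le (by positivity), ← Real.rpow_natCast (w t) 4,
                ← Real.rpow_mul hw', ← Real.rpow_natCast (w t) 3]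
              norm_num
      have e : (Vi - lvV M (x t)) ^ ((1:ℝ)/4 - 1) = ((Vi - lvV M (x t)) ^ ((3:ℝ)/4))⁻¹ := by
        rw [← Real.rpow_neg hu.le]; norm_num
      rw [e, ← hw6 t (hTnn.trans ht)]
      have hB : 0 < (Vi - lvV M (x t)) ^ ((3:ℝ)/4) := Real.rpow_pos_of_pos hu _
      set Bq := (Vi - lvV M (x t)) ^ ((3:ℝ)/4)
      have : (w t)^3 ≤ K ^ ((3:ℝ)/4) * (w t)^6 * Bq⁻¹ := by
        rw [← div_eq_mul_inv, le_div_iff₀ hB]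
        calc (w t)^3 * Bq ≤ (w t)^3 * (K ^ ((3:ℝ)/4) * (w t)^3) :=
              mul_le_mul_of_nonneg_left hA (by positivity)
          _ = _ := by ring
      simp only [c]
      linarith
    -- W converges
    have hWanti : MonotoneOn (fun t => -W t) (Set.Ici T) := by
      intro a ha b hb' hab
      have h1 : lvV M (x a) ≤ lvV M (x b) :=
        hmono (Set.mem_Ici.2 (hTnn.trans ha)) (Set.mem_Ici.2 (hTnn.trans hb')) hab
      exact neg_le_neg (Real.rpow_le_rpow (hpos b hb').le (by linarith) (by norm_num))
    have hW0 : ∀ t, T ≤ t → 0 ≤ W t := fun t ht => Real.rpow_nonneg (hpos t ht).le _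
    obtain ⟨lW, hlW, -⟩ := conv_of_mono _ T 0 hWanti (fun t ht => by linarith [hW0 t ht])
    have hc0 : 0 ≤ c := by positivity
    have hPd : ∀ t, T ≤ t → HasDerivAt (fun t => x t i - c * W t) _ t := fun t ht =>
      (hx t i).sub ((hWd t ht).const_mul c)
    have hP : MonotoneOn (fun t => x t i - c * W t) (Set.Ici T) := by
      apply monotoneOn_of_hasDerivWithinAt_nonneg (convex_Ici T)
        (fun t ht => (hPd t ht).continuousAt.continuousWithinAt)
        (fun t ht => (hPd t (interior_subset ht)).hasDerivWithinAt)
      intro t ht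
      have ht' : T ≤ t := interior_subset ht
      have h1 := hkey t ht'
      have h2 := (abs_le.1 (hspeed t (hTnn.trans ht') i)).1
      linarith
    obtain ⟨l, hl, -⟩ := conv_of_mono _ T 1 hP (fun t ht => by
      have := (hb t (hTnn.trans ht) i).2
      have := mul_nonneg hc0 (hW0 t ht)
      linarith)
    refine ⟨l - c * lW, (hl.sub (hlW.const_mul c)).congr fun t => ?_⟩
    ring
  · push Not at hpos
    obtain ⟨t1, ht1, hz⟩ := hpos
    have ht10 : 0 ≤ t1 := hTnn.trans ht1
    have hVc : ∀ t, t1 ≤ t → lvV M (x t) = Vi := fun t ht => by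
      have h1 : lvV M (x t1) ≤ lvV M (x t) :=
        hmono (Set.mem_Ici.2 ht10) (Set.mem_Ici.2 (ht10.trans ht)) ht
      have := hVle t (ht10.trans ht)
      linarith
    have hDz : ∀ t, t1 < t → lvD M (x t) = 0 := fun t ht => by
      have : HasDerivAt (fun t => lvV M (x t)) 0 t :=
        (hasDerivAt_const t Vi).congr_of_eventuallyEq (by
          filter_upwards [lt_mem_nhds ht] with s hs using hVc s hs.le)
      exact (hV t).unique this
    have hxd : ∀ t, t1 < t → x t i * (1 - M.mulVec (x t) i) = 0 := fun t ht => by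
      have ht0 : 0 ≤ t := ht10.trans ht.le
      have h1 := hspeed t ht0 i
      have h2 : (w t)^6 = 0 := by rw [hw6 t ht0, hDz t ht]
      have h3 : w t = 0 := by simpa using h2
      rw [h3, zero_pow (by norm_num)] at h1
      exact abs_nonpos_iff.1 h1
    have hP : MonotoneOn (fun t => x t i) (Set.Ici t1) := by
      apply monotoneOn_of_hasDerivWithinAt_nonneg (convex_Ici t1)
        (fun t _ => (hx t i).continuousAt.continuousWithinAt)
        (fun t _ => (hx t i).hasDerivWithinAt)
      intro t ht
      rw [interior_Ici] at ht
      exact (hxd t ht).ge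
    obtain ⟨l, hl, -⟩ := conv_of_mono _ t1 1 hP (fun t ht => (hb t (ht10.trans ht) i).2)
    exact ⟨l, hl⟩

/-- a convergent function with convergent derivative has derivative limit zero -/
lemma deriv_lim_zero (f f' : ℝ → ℝ) (a b : ℝ) (hd : ∀ t, HasDerivAt f (f' t) t)
    (hf : Tendsto f atTop (𝓝 a)) (hf' : Tendsto f' atTop (𝓝 b)) : b = 0 := by
  have h : ∀ t, ∃ s, t < s ∧ f' s = f (t + 1) - f t := by
    intro t
    obtain ⟨s, hs, h⟩ := exists_hasDerivAt_eq_slope f f' (lt_add_one t)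
      (fun s _ => (hd s).continuousAt.continuousWithinAt) (fun s _ => hd s)
    exact ⟨s, hs.1, by rw [h]; simp⟩
  choose s hs he using h
  have h1 : Tendsto (fun t => f' (s t)) atTop (𝓝 b) :=
    hf'.comp (tendsto_atTop_mono (fun t => (hs t).le) tendsto_id)
  have h2 : Tendsto (fun t => f (t + 1) - f t) atTop (𝓝 (a - a)) :=
    (hf.comp (tendsto_atTop_add_const_right _ 1 tendsto_id)).sub hf
  simp only [he] at h1
  rw [sub_self] at h2
  exact tendsto_nhds_unique h1 h2

theorem lv_converges_to_equilibrium {n : ℕ}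
    (A : Matrix (Fin n) (Fin n) ℝ)
    (hAsymm : A.IsSymm) (hA01 : ∀ i j, A i j = 0 ∨ A i j = 1) (hAdiag : ∀ i, A i i = 0)
    (τ : ℝ) (hτ : 0 < τ)
    (x : ℝ → Fin n → ℝ) (hx : IsLVSol (τ • A + 1) x)
    (hx0 : ∀ i, x 0 i ∈ Set.Icc (0:ℝ) 1) :
    ∃ xs : Fin n → ℝ, Tendsto x atTop (𝓝 xs) ∧
      ∀ i, xs i * (1 - (τ • A + 1).mulVec xs i) = 0 := by
  have hM : (τ • A + 1).IsSymm := (hAsymm.smul τ).add Matrix.isSymm_one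
  have hxc : ∀ i, Continuous fun t => x t i := fun i =>
    continuous_iff_continuousAt.2 fun t => (hx t i).continuousAt
  have hxc' : Continuous x := continuous_pi hxc
  have hmc : ∀ i, Continuous fun y : Fin n → ℝ => (τ • A + 1).mulVec y i := fun i => by
    unfold Matrix.mulVec dotProduct; fun_prop
  have hnn : ∀ t, 0 ≤ t → ∀ i, 0 ≤ x t i := fun t ht i =>
    comparison (fun t => x t i) (fun t => 1 - (τ • A + 1).mulVec (x t) i) _
      (continuous_const.sub ((hmc i).comp hxc')) (fun t => hx t i) (hx0 i).1
      (fun t _ => (mul_comm _ _).le) t ht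
  have hle1 : ∀ t, 0 ≤ t → ∀ i, x t i ≤ 1 := fun t ht i => by
    have := comparison (fun t => 1 - x t i) (fun t => - x t i) _
      (hxc i).neg (fun t => (hx t i).const_sub 1) (sub_nonneg.2 (hx0 i).2)
      (fun t ht => by
        have h1 := hnn t ht i
        have h2 : x t i ≤ (τ • A + 1).mulVec (x t) i := by
          rw [Matrix.add_mulVec, Matrix.one_mulVec, Pi.add_apply]
          have : 0 ≤ (τ • A).mulVec (x t) i := by
            unfold Matrix.mulVec dotProduct
            refine Finset.sum_nonneg fun j _ => mul_nonneg ?_ (hnn t ht j)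
            rcases hA01 i j with h | h <;> simp [h, hτ.le]
          linarith
        nlinarith) t ht
    simpa using this
  obtain ⟨xs, hxs⟩ := lv_conv _ hM x hx fun t ht i => ⟨hnn t ht i, hle1 t ht i⟩
  refine ⟨xs, hxs, fun i => ?_⟩
  have hxi := (tendsto_pi_nhds.1 hxs) i
  have hd : Tendsto (fun t => x t i * (1 - (τ • A + 1).mulVec (x t) i)) atTop
      (𝓝 (xs i * (1 - (τ • A + 1).mulVec xs i))) :=
    hxi.mul ((((hmc i).tendsto xs).comp hxs).const_sub 1)
  exact deriv_lim_zero _ _ _ _ (fun t => hx t i) hxi hd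
end

section
/- Let G be a finite simple undirected graph on n vertices with adjacency matrix A, let τ > 1, and set M = τ·A + I. Then there exists a set Ω ⊆ ℝⁿ of Lebesgue measure zero such that for every x₀ ∈ (0,1)ⁿ \ Ω and every solution x of the Lotka–Volterra system with x(0) = x₀ defined for all t ≥ 0 whose limit x* = lim_{t→∞} x(t) exists, the limit x* is a binary vector, i.e., every coordinate of x* belongs to {0,1}. -/
open MeasureTheory Matrix Filter Topology

theorem null_of_cone {n : ℕ} (P : Matrix (Fin n) (Fin n) ℝ) (e : Fin n → ℝ)
    (he : e ⬝ᵥ P.mulVec e < 0) (Y : Set (Fin n → ℝ))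
    (hY : ∀ a ∈ Y, ∀ b ∈ Y, 0 ≤ (a - b) ⬝ᵥ P.mulVec (a - b)) : volume Y = 0 := by
  have hc : ∀ a ∈ closure Y, ∀ b ∈ closure Y, 0 ≤ (a - b) ⬝ᵥ P.mulVec (a - b) := by
    have hcl : IsClosed {p : (Fin n → ℝ) × (Fin n → ℝ) |
        0 ≤ (p.1 - p.2) ⬝ᵥ P.mulVec (p.1 - p.2)} := by
      apply isClosed_le continuous_const
      simp only [dotProduct, mulVec]
      fun_prop
    have : closure (Y ×ˢ Y) ⊆ {p : (Fin n → ℝ) × (Fin n → ℝ) |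
        0 ≤ (p.1 - p.2) ⬝ᵥ P.mulVec (p.1 - p.2)} := by
      apply closure_minimal _ hcl
      rintro ⟨a, b⟩ ⟨ha, hb⟩
      exact hY a ha b hb
    intro a ha b hb
    rw [closure_prod_eq] at this
    exact @this (a, b) ⟨ha, hb⟩
  refine measure_mono_null subset_closure ?_
  refine Measure.addHaar_eq_zero_of_disjoint_translates volume
    (fun k : ℕ => (1 / ((k : ℝ) + 1)) • e) ?_ ?_ isClosed_closure.measurableSet
  · refine (Metric.isBounded_closedBall (x := (0 : Fin n → ℝ)) (r := ‖e‖)).subset ?_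
    rintro _ ⟨k, rfl⟩
    simp only [mem_closedBall_zero_iff, norm_smul]
    have : ‖(1 / ((k : ℝ) + 1))‖ ≤ 1 := by
      rw [Real.norm_of_nonneg (by positivity)]
      rw [div_le_one (by positivity)]; linarith [(Nat.cast_nonneg k : (0:ℝ) ≤ k)]
    nlinarith [norm_nonneg e]
  · intro k l hkl
    rw [Function.onFun, Set.disjoint_left]
    rintro z hz1 hz2
    simp only [Set.singleton_add, Set.mem_image] at hz1 hz2
    obtain ⟨a, ha, rfl⟩ := hz1
    obtain ⟨b, hb, hab⟩ := hz2
    have h1 := hc a ha b hb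
    have h2 : a - b = (1 / ((l : ℝ) + 1) - 1 / ((k : ℝ) + 1)) • e := by
      rw [sub_smul, sub_eq_sub_iff_add_eq_add]
      rw [add_comm a, ← hab]
    rw [h2, mulVec_smul, smul_dotProduct, dotProduct_smul, smul_eq_mul, smul_eq_mul,
      ← mul_assoc] at h1
    have h3 : (1 / ((l : ℝ) + 1) - 1 / ((k : ℝ) + 1)) ≠ 0 := by
      intro h
      apply hkl
      have h' := sub_eq_zero.mp h
      rw [one_div, one_div, _root_.inv_inj] at h'
      have : (l : ℝ) = k := by linarith
      exact_mod_cast this.symm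
    have := mul_self_pos.mpr h3
    nlinarith

theorem null_of_lip {n : ℕ} {ι : Type*} (f g : ι → Fin n → ℝ) (C : ℝ)
    (h : ∀ i j, ‖f i - f j‖ ≤ C * ‖g i - g j‖) (hg : volume (Set.range g) = 0) :
    volume (Set.range f) = 0 := by
  rcases isEmpty_or_nonempty ι with hι | hι
  · simp [Set.range_eq_empty]
  set F : (Fin n → ℝ) → (Fin n → ℝ) := fun y => f (Function.invFun g y)
  have hF : ∀ i, F (g i) = f i := by
    intro i
    have h1 : g (Function.invFun g (g i)) = g i := Function.invFun_eq ⟨i, rfl⟩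
    have h2 := h (Function.invFun g (g i)) i
    rw [h1, sub_self, norm_zero, mul_zero] at h2
    exact sub_eq_zero.mp (norm_le_zero_iff.mp h2)
  have hL : LipschitzOnWith (Real.toNNReal C) F (Set.range g) := by
    apply LipschitzOnWith.of_dist_le_mul
    rintro _ ⟨i, rfl⟩ _ ⟨j, rfl⟩
    rw [hF, hF, dist_eq_norm, dist_eq_norm]
    refine (h i j).trans ?_
    gcongr
    exact Real.le_coe_toNNReal C
  have hR : Set.range f = F '' Set.range g := by
    rw [← Set.range_comp]
    congr 1
    ext1 i
    exact (hF i).symm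
  have := hL.hausdorffMeasure_image_le (d := (Fintype.card (Fin n) : ℝ)) (by positivity)
  rw [hR]
  rw [hausdorffMeasure_pi_real] at this
  rw [hg, mul_zero] at this
  exact le_antisymm this (by simp)

theorem log_bounds {a b : ℝ} (ha : 0 < a) (hb : 0 < b) :
    b * (Real.log a - Real.log b) ≤ a - b ∧ a - b ≤ a * (Real.log a - Real.log b) := by
  have h1 := Real.log_le_sub_one_of_pos (div_pos ha hb)
  have h2 := Real.log_le_sub_one_of_pos (div_pos hb ha)
  rw [Real.log_div ha.ne' hb.ne'] at h1
  rw [Real.log_div hb.ne' ha.ne'] at h2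
  constructor
  · have := mul_le_mul_of_nonneg_left h1 hb.le
    have h3 : b * (a / b - 1) = a - b := by field_simp
    linarith
  · have := mul_le_mul_of_nonneg_left h2 ha.le
    have h3 : a * (b / a - 1) = b - a := by field_simp
    linarith

theorem log_lin {a b d η : ℝ} (ha : 0 < a) (hb : 0 < b) (had : |a - d| ≤ η) (hbd : |b - d| ≤ η) :
    |a - b - d * (Real.log a - Real.log b)| ≤ η * |Real.log a - Real.log b| := by
  obtain ⟨h1, h2⟩ := log_bounds ha hb
  rw [abs_le] at had hbd
  rcases le_total 0 (Real.log a - Real.log b) with h | h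
  · rw [abs_of_nonneg h, abs_le]
    constructor <;> nlinarith
  · rw [abs_of_nonpos h, abs_le]
    constructor <;> nlinarith

theorem log_lip {a b R : ℝ} (ha : 0 < a) (hb : 0 < b) (haR : a ≤ R) (hbR : b ≤ R) :
    |a - b| ≤ R * |Real.log a - Real.log b| := by
  obtain ⟨h1, h2⟩ := log_bounds ha hb
  rcases le_total 0 (Real.log a - Real.log b) with h | h
  · rw [abs_of_nonneg h, abs_le]
    constructor <;> nlinarith
  · rw [abs_of_nonpos h, abs_le]
    constructor <;> nlinarith

theorem bil_bound {n : ℕ} (B : Matrix (Fin n) (Fin n) ℝ) :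
    ∃ K : ℝ, 0 < K ∧ ∀ (θ : ℝ), 0 < θ → ∀ a b : Fin n → ℝ,
      |a ⬝ᵥ B.mulVec b| ≤ K * (θ * (a ⬝ᵥ a) + θ⁻¹ * (b ⬝ᵥ b)) := by
  refine ⟨∑ i, ∑ j, |B i j| + 1, by positivity, ?_⟩
  intro θ hθ a b
  have e1 : a ⬝ᵥ B.mulVec b = ∑ i, ∑ j, a i * (B i j * b j) := by
    simp [dotProduct, mulVec, Finset.mul_sum]
  have ha : ∀ i, a i * a i ≤ a ⬝ᵥ a := fun i =>
    Finset.single_le_sum (f := fun i => a i * a i) (fun j _ => mul_self_nonneg (a j))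
      (Finset.mem_univ i)
  have hb : ∀ i, b i * b i ≤ b ⬝ᵥ b := fun i =>
    Finset.single_le_sum (f := fun i => b i * b i) (fun j _ => mul_self_nonneg (b j))
      (Finset.mem_univ i)
  have ha0 : 0 ≤ a ⬝ᵥ a := Finset.sum_nonneg (fun j _ => mul_self_nonneg (a j))
  have hb0 : 0 ≤ b ⬝ᵥ b := Finset.sum_nonneg (fun j _ => mul_self_nonneg (b j))
  set X := θ * (a ⬝ᵥ a) + θ⁻¹ * (b ⬝ᵥ b) with hX
  have hX0 : 0 ≤ X := by positivity
  have key : ∀ i j, |a i * b j| ≤ X := by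
    intro i j
    have h1 : θ * (a i * a i) + θ⁻¹ * (b j * b j) ≤ X := by
      have := ha i; have := hb j
      rw [hX]; gcongr
    have h2 : 2 * |a i * b j| ≤ θ * (a i * a i) + θ⁻¹ * (b j * b j) := by
      have h4 : 0 ≤ θ⁻¹ * (θ * |a i| - |b j|) ^ 2 := by positivity
      have h5 : θ⁻¹ * (θ * |a i| - |b j|) ^ 2
          = θ * |a i| ^ 2 + θ⁻¹ * |b j| ^ 2 - 2 * (|a i| * |b j|) := by
        field_simp; ring
      rw [abs_mul]
      rw [h5, sq_abs, sq_abs] at h4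
      nlinarith
    have := abs_nonneg (a i * b j)
    linarith
  rw [e1]
  calc |∑ i, ∑ j, a i * (B i j * b j)| ≤ ∑ i, ∑ j, |B i j| * X := by
        refine (Finset.abs_sum_le_sum_abs _ _).trans (Finset.sum_le_sum fun i _ => ?_)
        refine (Finset.abs_sum_le_sum_abs _ _).trans (Finset.sum_le_sum fun j _ => ?_)
        have : a i * (B i j * b j) = B i j * (a i * b j) := by ring
        rw [this, abs_mul]
        exact mul_le_mul_of_nonneg_left (key i j) (abs_nonneg _)
    _ = (∑ i, ∑ j, |B i j|) * X := by simp_rw [Finset.sum_mul]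
    _ ≤ _ := by nlinarith

theorem exists_c {n : ℕ} (B : Matrix (Fin n) (Fin n) ℝ) (c₀ : ℝ) (h : 0 < c₀) :
    ∃ c, 0 < c ∧ c < c₀ ∧ (B + c • (1 : Matrix (Fin n) (Fin n) ℝ)).det ≠ 0 := by
  have hfin : {c : ℝ | (-B).charpoly.IsRoot c}.Finite :=
    Polynomial.finite_setOfPred_isRoot (Matrix.charpoly_monic _).ne_zero
  obtain ⟨c, hc, hc2⟩ := ((Set.Ioo_infinite h).sdiff hfin).nonempty
  refine ⟨c, hc.1, hc.2, fun h0 => hc2 ?_⟩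
  simp only [Set.mem_ofPred_eq, Polynomial.IsRoot, Matrix.eval_charpoly]
  rw [← h0]
  congr 1
  rw [sub_neg_eq_add, add_comm, Matrix.smul_one_eq_diagonal]
  rfl

theorem dir_facts {n : ℕ} (M : Matrix (Fin n) (Fin n) ℝ) (hM : M.IsSymm)
    (d : Fin n → ℝ) (i j : Fin n) (hij : i ≠ j) (hi : 0 < d i) (hj : 0 < d j)
    (hii : M i i = 1) (hjj : M j j = 1) :
    let e : Fin n → ℝ := Pi.single i (1 / d i) - Pi.single j (1 / d j)
    (d * e) ⬝ᵥ M.mulVec (d * e) = 2 - 2 * M i j ∧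
    ∑ k, d k * (e k * e k) = 1 / d i + 1 / d j ∧
    e ⬝ᵥ e = 1 / d i ^ 2 + 1 / d j ^ 2 := by
  intro e
  have hMji : M j i = M i j := hM.apply i j
  have hde : d * e = Pi.single i 1 - Pi.single j 1 := by
    ext k
    simp only [e, Pi.mul_apply, Pi.sub_apply, Pi.single_apply, mul_sub]
    by_cases h1 : k = i
    · subst h1; simp [hij, hi.ne']
    · by_cases h2 : k = j
      · subst h2; simp [h1, hj.ne']
      · simp [h1, h2]
  refine ⟨?_, ?_, ?_⟩
  · rw [hde]
    simp only [sub_dotProduct, mulVec_sub, dotProduct_sub, single_one_dotProduct,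
      mulVec_single_one, Matrix.col_apply, hii, hjj, hMji]
    ring
  · have : ∀ k, d k * (e k * e k) = Pi.single (M := fun _ => ℝ) i (1 / d i) k
        + Pi.single (M := fun _ => ℝ) j (1 / d j) k := by
      intro k
      simp only [e, Pi.sub_apply, Pi.single_apply]
      by_cases h1 : k = i
      · subst h1; simp [hij, hi.ne']
      · by_cases h2 : k = j
        · subst h2; simp [h1, hj.ne']
        · simp [h1, h2]
    simp [this, Finset.sum_add_distrib]
  · have : ∀ k, e k * e k = Pi.single (M := fun _ => ℝ) i (1 / d i ^ 2) k
        + Pi.single (M := fun _ => ℝ) j (1 / d j ^ 2) k := by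
      intro k
      simp only [e, Pi.sub_apply, Pi.single_apply]
      by_cases h1 : k = i
      · subst h1; simp [hij, sq]
      · by_cases h2 : k = j
        · subst h2; simp [h1, sq]
        · simp [h1, h2]
    simp [dotProduct, this, Finset.sum_add_distrib]

set_option maxHeartbeats 1000000 in
theorem cone_exists {n : ℕ} (M : Matrix (Fin n) (Fin n) ℝ) (hM : M.IsSymm)
    (d : Fin n → ℝ) (hd : ∀ k, 0 ≤ d k) (i j : Fin n) (hij : i ≠ j) (hi : 0 < d i) (hj : 0 < d j)
    (hii : M i i = 1) (hjj : M j j = 1) (hMij : 1 < M i j) :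
    ∃ (P : Matrix (Fin n) (Fin n) ℝ) (c η C : ℝ) (e : Fin n → ℝ),
      0 < c ∧ 0 < η ∧ (∀ k, 0 < d k → η < d k) ∧ e ⬝ᵥ P.mulVec e < 0 ∧ P.IsSymm ∧ 0 ≤ C ∧
      (∀ w : Fin n → ℝ, -C * ((d * w) ⬝ᵥ (d * w)) ≤ w ⬝ᵥ P.mulVec w) ∧
      ∀ w r : Fin n → ℝ, (∀ k, |r k| ≤ η * |w k|) →
        2 * (P.mulVec w ⬝ᵥ (-(M.mulVec (d * w + r)))) ≤ 2 * c * (w ⬝ᵥ P.mulVec w) := by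
  classical
  have hMji : M j i = M i j := hM.apply i j
  set b := 1 / d i + 1 / d j with hb
  have hb0 : 0 < b := by positivity
  set b2 := 1 / d i ^ 2 + 1 / d j ^ 2 with hb2
  have hb20 : 0 < b2 := by positivity
  obtain ⟨c, hc, hcc, hdet⟩ := exists_c (diagonal d * M) ((M i j - 1) / b)
    (div_pos (by linarith) hb0)
  have hcb : c * b < M i j - 1 := by rwa [lt_div_iff₀ hb0] at hcc
  set N := diagonal d * M + c • (1 : Matrix (Fin n) (Fin n) ℝ) with hN
  obtain ⟨KL, hKL, hKLb⟩ := bil_bound ((N⁻¹)ᵀ * N⁻¹)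
  obtain ⟨K, hK, hKb⟩ := bil_bound M
  set dm := ∑ k, d k with hdm
  have hdk : ∀ k, d k ≤ dm := fun k =>
    Finset.single_le_sum (f := d) (fun l _ => hd l) (Finset.mem_univ k)
  have hdm0 : 0 < dm := lt_of_lt_of_le hi (hdk i)
  set δ := 1 / (2 * KL * dm) with hδ
  have hδ0 : 0 < δ := by positivity
  -- choose ε
  set ε := min (δ * c / (2 * K ^ 2)) ((M i j - 1) / b2 / 2) with hε
  have hε0 : 0 < ε := by
    apply lt_min
    · positivity
    · have : 0 < M i j - 1 := by linarith
      positivity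
  have hε1 : ε ≤ δ * c / (2 * K ^ 2) := min_le_left _ _
  have hε2 : ε * b2 < M i j - 1 := by
    have h1 : ε ≤ (M i j - 1) / b2 / 2 := min_le_right _ _
    have h2 : (M i j - 1) / b2 / 2 * b2 = (M i j - 1) / 2 := by field_simp
    nlinarith
  set P := diagonal d * M * diagonal d + c • diagonal d
    + ε • (1 : Matrix (Fin n) (Fin n) ℝ) with hP
  have hdw : ∀ w : Fin n → ℝ, (diagonal d).mulVec w = d * w := by
    intro w; ext k; simp [mulVec_diagonal]
  have hPw : ∀ w k, P.mulVec w k = d k * M.mulVec (d * w) k + c * (d k * w k) + ε * w k := by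
    intro w k
    simp only [hP, add_mulVec, smul_mulVec, one_mulVec, ← mulVec_mulVec, hdw, Pi.add_apply,
      Pi.smul_apply, smul_eq_mul, Pi.mul_apply]
  have hPsymm : P.IsSymm := by
    unfold Matrix.IsSymm
    simp only [hP, transpose_add, transpose_mul, transpose_smul, diagonal_transpose, transpose_one,
      hM.eq, Matrix.mul_assoc]
  obtain ⟨KB, hKB, hKBb⟩ := bil_bound (Pᵀ * M)
  -- choose η
  obtain ⟨η₁, hη₁, hη₁d⟩ : ∃ η₁ : ℝ, 0 < η₁ ∧ ∀ k, 0 < d k → η₁ < d k := by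
    have hev : ∀ᶠ t in 𝓝[>] (0 : ℝ), ∀ k, 0 < d k → t < d k := by
      rw [eventually_all]
      intro k
      by_cases hk : 0 < d k
      · filter_upwards [nhdsWithin_le_nhds (Iio_mem_nhds hk)] with t ht _ using ht
      · exact Eventually.of_forall fun t h => absurd h hk
    obtain ⟨t, h1, h2⟩ := (hev.and self_mem_nhdsWithin).exists
    exact ⟨t, h2, h1⟩
  set η := min η₁ (c * ε / (4 * KB)) with hη
  have hη0 : 0 < η := lt_min hη₁ (by positivity)
  have hη2 : 4 * KB * η ≤ c * ε := by
    have h1 : η ≤ c * ε / (4 * KB) := min_le_right _ _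
    rw [le_div_iff₀ (by positivity)] at h1
    linarith
  have hsq : ∀ a : Fin n → ℝ, 0 ≤ a ⬝ᵥ a := fun a =>
    Finset.sum_nonneg fun k _ => mul_self_nonneg (a k)
  have hPww : ∀ w : Fin n → ℝ, w ⬝ᵥ P.mulVec w = (d * w) ⬝ᵥ M.mulVec (d * w)
      + c * (∑ k, d k * (w k * w k)) + ε * (w ⬝ᵥ w) := by
    intro w
    simp only [dotProduct, hPw, Pi.mul_apply, Finset.mul_sum, ← Finset.sum_add_distrib]
    exact Finset.sum_congr rfl fun k _ => by ring
  set e : Fin n → ℝ := Pi.single i (1 / d i) - Pi.single j (1 / d j) with he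
  refine ⟨P, c, η, 2 * K, e, hc, hη0, fun k hk => lt_of_le_of_lt (min_le_left _ _) (hη₁d k hk),
    ?_, hPsymm, by positivity, ?_, ?_⟩
  · obtain ⟨h1, h2, h3⟩ := dir_facts M hM d i j hij hi hj hii hjj
    rw [← he] at h1 h2 h3
    rw [hPww, h1, h2, h3]
    linarith
  · intro w
    have h1 := abs_le.mp (hKb 1 one_pos (d * w) (d * w))
    have h2 : 0 ≤ ∑ k, d k * (w k * w k) :=
      Finset.sum_nonneg fun k _ => mul_nonneg (hd k) (mul_self_nonneg _)
    have h3 := mul_nonneg hc.le h2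
    have h4 := mul_nonneg hε0.le (hsq w)
    rw [hPww]
    norm_num at h1
    nlinarith [h1.1]
  · intro w r hr
    set m := M.mulVec (d * w) with hm
    set μ := M.mulVec r with hμ
    set Q := ∑ k, d k * (m k + c * w k) ^ 2 with hQ
    have hid : 2 * (P.mulVec w ⬝ᵥ (-(M.mulVec (d * w + r)))) - 2 * c * (w ⬝ᵥ P.mulVec w)
        = -2 * Q - 2 * ε * (w ⬝ᵥ m) - 2 * c * ε * (w ⬝ᵥ w) - 2 * (P.mulVec w ⬝ᵥ μ) := by
      rw [mulVec_add, ← hm, ← hμ]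
      simp only [dotProduct, hPw, ← hm, hQ, Finset.mul_sum, ← Finset.sum_sub_distrib, Pi.neg_apply,
        Pi.add_apply]
      exact Finset.sum_congr rfl fun k _ => by ring
    -- Q controls s
    have hNs : N.mulVec (d * w) = fun k => d k * (m k + c * w k) := by
      ext k
      simp only [hN, add_mulVec, smul_mulVec, one_mulVec, ← mulVec_mulVec, hdw, Pi.add_apply,
        Pi.smul_apply, smul_eq_mul, Pi.mul_apply, ← hm]
      ring
    have hS : δ * ((d * w) ⬝ᵥ (d * w)) ≤ Q := by
      set q := N.mulVec (d * w) with hq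
      have h1 : d * w = N⁻¹.mulVec q := by
        rw [hq, mulVec_mulVec, nonsing_inv_mul _ (isUnit_iff_ne_zero.mpr hdet), one_mulVec]
      have h2 : (d * w) ⬝ᵥ (d * w) = q ⬝ᵥ ((N⁻¹)ᵀ * N⁻¹).mulVec q := by
        rw [← mulVec_mulVec, dotProduct_mulVec, vecMul_transpose, ← h1]
      have h3 := (abs_le.mp (hKLb 1 one_pos q q)).2
      have h4 : q ⬝ᵥ q ≤ dm * Q := by
        rw [hNs, hQ, Finset.mul_sum]
        refine Finset.sum_le_sum fun k _ => ?_
        have h5 : 0 ≤ d k * (m k + c * w k) ^ 2 := mul_nonneg (hd k) (sq_nonneg _)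
        nlinarith [hdk k]
      rw [h2, hδ, div_mul_eq_mul_div, one_mul, div_le_iff₀ (by positivity)]
      norm_num at h3
      nlinarith
    have hwm : |w ⬝ᵥ m| ≤ c / 2 * (w ⬝ᵥ w) + 2 * K ^ 2 / c * ((d * w) ⬝ᵥ (d * w)) := by
      refine (hKb (c / (2 * K)) (by positivity) w (d * w)).trans (le_of_eq ?_)
      field_simp
    have hPμ : |P.mulVec w ⬝ᵥ μ| ≤ 2 * KB * η * (w ⬝ᵥ w) := by
      have h1 : P.mulVec w ⬝ᵥ μ = w ⬝ᵥ (Pᵀ * M).mulVec r := by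
        rw [← mulVec_mulVec, dotProduct_mulVec w, vecMul_transpose]
      have hrr : r ⬝ᵥ r ≤ η ^ 2 * (w ⬝ᵥ w) := by
        simp only [dotProduct, Finset.mul_sum]
        refine Finset.sum_le_sum fun k _ => ?_
        have h3 : |r k| * |r k| ≤ (η * |w k|) * (η * |w k|) :=
          mul_self_le_mul_self (abs_nonneg _) (hr k)
        have h4 := abs_mul_abs_self (r k)
        have h5 := abs_mul_abs_self (w k)
        nlinarith
      have h2 := hKBb η hη0 w r
      rw [h1]
      refine h2.trans ?_
      have h6 : η⁻¹ * (r ⬝ᵥ r) ≤ η * (w ⬝ᵥ w) := by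
        rw [inv_mul_le_iff₀ hη0]; linarith
      nlinarith
    have h1 := abs_le.mp hwm
    have h2 := abs_le.mp hPμ
    have hW := hsq w
    have hSS := hsq (d * w)
    set W := w ⬝ᵥ w
    set S := (d * w) ⬝ᵥ (d * w)
    have h3 : ε * (2 * K ^ 2 / c) ≤ δ := by
      rw [le_div_iff₀ (by positivity)] at hε1
      rw [← mul_div_assoc, div_le_iff₀ hc]
      linarith
    have h4 : -2 * ε * (w ⬝ᵥ m) ≤ c * ε * W + 2 * δ * S := by
      have h5 := mul_le_mul_of_nonneg_left h1.1 hε0.le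
      have h6 := mul_le_mul_of_nonneg_right h3 hSS
      nlinarith
    have h5 : 4 * KB * η * W ≤ c * ε * W := mul_le_mul_of_nonneg_right hη2 hW
    have h6 : 0 ≤ c * ε * W := by positivity
    linarith [h2.1]

theorem lv_cont {n : ℕ} {M : Matrix (Fin n) (Fin n) ℝ} {x : ℝ → Fin n → ℝ} (h : IsLVSol M x) :
    Continuous x :=
  continuous_pi fun i => continuous_iff_continuousAt.mpr fun t => (h t i).continuousAt

theorem lv_pos {n : ℕ} {M : Matrix (Fin n) (Fin n) ℝ} {x : ℝ → Fin n → ℝ} (h : IsLVSol M x)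
    (i : Fin n) (h0 : 0 < x 0 i) (t : ℝ) : 0 < x t i := by
  have hx := lv_cont h
  set g : ℝ → ℝ := fun s => 1 - M.mulVec (x s) i with hg
  have hgc : Continuous g := by
    simp only [hg, mulVec, dotProduct]
    fun_prop
  set F : ℝ → ℝ := fun t => ∫ s in (0:ℝ)..t, g s with hF
  have hFd : ∀ t, HasDerivAt F (g t) t := fun t => (hgc.integral_hasStrictDerivAt 0 t).hasDerivAt
  have hd : ∀ t, HasDerivAt (fun s => x s i * Real.exp (-F s)) 0 t := by
    intro t
    have := (h t i).mul (hFd t).neg.exp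
    refine this.congr_deriv ?_
    simp only [hg, Pi.neg_apply]; ring
  have hconst := is_const_of_deriv_eq_zero (fun t => (hd t).differentiableAt)
    (fun t => (hd t).deriv) t 0
  have hF0 : F 0 = 0 := by simp [hF]
  simp only [hF0, neg_zero, Real.exp_zero, mul_one] at hconst
  rw [← hconst] at h0
  exact pos_of_mul_pos_left h0 (Real.exp_pos _).le

/-- logarithmic coordinates -/
noncomputable def lg {n : ℕ} (x : Fin n → ℝ) : Fin n → ℝ := fun i => Real.log (x i)

theorem lg_deriv {n : ℕ} {M : Matrix (Fin n) (Fin n) ℝ} {x y : ℝ → Fin n → ℝ} (h : IsLVSol M x)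
    (hy : IsLVSol M y) (px : ∀ t i, 0 < x t i) (py : ∀ t i, 0 < y t i) (t : ℝ) :
    HasDerivAt (fun s => lg (x s) - lg (y s)) (-(M.mulVec (x t - y t))) t := by
  rw [hasDerivAt_pi]
  intro i
  have h1 := (h t i).log (px t i).ne'
  have h2 := (hy t i).log (py t i).ne'
  have h3 := h1.sub h2
  refine h3.congr_deriv ?_
  have := (px t i).ne'
  have := (py t i).ne'
  rw [mulVec_sub]
  simp only [Pi.neg_apply, Pi.sub_apply]
  field_simp
  ring

theorem pair_lip {n : ℕ} (M : Matrix (Fin n) (Fin n) ℝ) (T R : ℝ) (hT : 0 ≤ T) (hR : 0 ≤ R) :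
    ∃ C : ℝ, ∀ x y : ℝ → Fin n → ℝ, IsLVSol M x → IsLVSol M y →
      (∀ t i, 0 < x t i) → (∀ t i, 0 < y t i) →
      (∀ t ∈ Set.Icc 0 T, ∀ i, x t i ≤ R) → (∀ t ∈ Set.Icc 0 T, ∀ i, y t i ≤ R) →
      ‖x 0 - y 0‖ ≤ C * ‖lg (x T) - lg (y T)‖ := by
  set L := M.mulVecLin.toContinuousLinearMap with hL
  refine ⟨R * Real.exp (‖L‖ * R * T), ?_⟩
  intro x y hx hy px py bx by'
  have hz : ∀ t ∈ Set.Icc 0 T, ‖x t - y t‖ ≤ R * ‖lg (x t) - lg (y t)‖ := by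
    intro t ht
    rw [pi_norm_le_iff_of_nonneg (by positivity)]
    intro i
    refine (log_lip (px t i) (py t i) (bx t ht i) (by' t ht i)).trans ?_
    gcongr
    exact norm_le_pi_norm (lg (x t) - lg (y t)) i
  set w : ℝ → Fin n → ℝ := fun s => lg (x s) - lg (y s) with hw
  have hwd := lg_deriv hx hy px py
  have hfd : ∀ s, HasDerivAt (fun s => w (T - s)) (M.mulVec (x (T - s) - y (T - s))) s := by
    intro s
    have h1 := (hwd (T - s)).scomp s ((hasDerivAt_id s).const_sub T)
    refine h1.congr_deriv ?_
    simp
  have hg := norm_le_gronwallBound_of_norm_deriv_right_le (f := fun s => w (T - s))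
    (f' := fun s => M.mulVec (x (T - s) - y (T - s))) (δ := ‖w T‖) (K := ‖L‖ * R) (ε := 0)
    (a := 0) (b := T) (fun s _ => (hfd s).continuousAt.continuousWithinAt)
    (fun s _ => (hfd s).hasDerivWithinAt) (by simp) (by
      intro s hs
      have h1 : ‖L (x (T - s) - y (T - s))‖ ≤ ‖L‖ * ‖x (T - s) - y (T - s)‖ := L.le_opNorm _
      have h2 := hz (T - s) ⟨by linarith [hs.2], by linarith [hs.1]⟩
      have h3 : ‖L‖ * ‖x (T - s) - y (T - s)‖ ≤ ‖L‖ * (R * ‖w (T - s)‖) := by gcongr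
      have h4 : L (x (T - s) - y (T - s)) = M.mulVec (x (T - s) - y (T - s)) := rfl
      rw [h4] at h1
      linarith) T ⟨hT, le_rfl⟩
  rw [gronwallBound_ε0] at hg
  simp only [sub_self, sub_zero] at hg
  have h0 := hz 0 ⟨le_rfl, hT⟩
  calc ‖x 0 - y 0‖ ≤ R * ‖w 0‖ := h0
    _ ≤ R * (‖w T‖ * Real.exp (‖L‖ * R * T)) := by gcongr
    _ = _ := by ring

theorem pair_cone {n : ℕ} (M : Matrix (Fin n) (Fin n) ℝ) (d : Fin n → ℝ) (hd : ∀ k, 0 ≤ d k)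
    (P : Matrix (Fin n) (Fin n) ℝ) (c η C : ℝ) (hc : 0 < c)
    (hηd : ∀ k, 0 < d k → η < d k) (hP : P.IsSymm) (hC : 0 ≤ C)
    (hlow : ∀ w : Fin n → ℝ, -C * ((d * w) ⬝ᵥ (d * w)) ≤ w ⬝ᵥ P.mulVec w)
    (hcone : ∀ w r : Fin n → ℝ, (∀ k, |r k| ≤ η * |w k|) →
        2 * (P.mulVec w ⬝ᵥ (-(M.mulVec (d * w + r)))) ≤ 2 * c * (w ⬝ᵥ P.mulVec w))
    (x y : ℝ → Fin n → ℝ) (hx : IsLVSol M x) (hy : IsLVSol M y)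
    (px : ∀ t i, 0 < x t i) (py : ∀ t i, 0 < y t i) (T : ℝ)
    (bx : ∀ t, T ≤ t → ∀ k, |x t k - d k| ≤ η) (by' : ∀ t, T ≤ t → ∀ k, |y t k - d k| ≤ η) :
    0 ≤ (lg (x T) - lg (y T)) ⬝ᵥ P.mulVec (lg (x T) - lg (y T)) := by
  by_contra hneg
  push Not at hneg
  set w : ℝ → Fin n → ℝ := fun s => lg (x s) - lg (y s) with hw
  have hwd := lg_deriv hx hy px py
  set V : ℝ → ℝ := fun t => w t ⬝ᵥ P.mulVec (w t) with hV
  set w' : ℝ → Fin n → ℝ := fun t => -(M.mulVec (x t - y t)) with hw'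
  have hVd : ∀ t, HasDerivAt V (2 * (P.mulVec (w t) ⬝ᵥ w' t)) t := by
    intro t
    have hwi : ∀ k, HasDerivAt (fun s => w s k) (w' t k) t := fun k => hasDerivAt_pi.mp (hwd t) k
    have h1 : HasDerivAt (fun s => ∑ k, w s k * ∑ l, P k l * w s l)
        (∑ k, (w' t k * (∑ l, P k l * w t l) + w t k * ∑ l, P k l * w' t l)) t := by
      apply HasDerivAt.fun_sum
      intro k _
      refine (hwi k).mul ?_
      apply HasDerivAt.fun_sum
      intro l _
      exact (hwi l).const_mul _
    refine h1.congr_deriv ?_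
    rw [Finset.sum_add_distrib]
    have e1 : ∑ k, w' t k * (∑ l, P k l * w t l) = P.mulVec (w t) ⬝ᵥ w' t := by
      rw [dotProduct_comm]; rfl
    have e2 : ∑ k, w t k * ∑ l, P k l * w' t l = P.mulVec (w t) ⬝ᵥ w' t := by
      have : ∑ k, w t k * ∑ l, P k l * w' t l = w t ⬝ᵥ P.mulVec (w' t) := rfl
      rw [this, dotProduct_mulVec, ← mulVec_transpose, hP.eq]
    rw [e1, e2]; ring
  have hle : ∀ t, T ≤ t → 2 * (P.mulVec (w t) ⬝ᵥ w' t) ≤ 2 * c * V t := by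
    intro t ht
    have := hcone (w t) (x t - y t - d * w t) (fun k =>
      log_lin (px t k) (py t k) (bx t ht k) (by' t ht k))
    rwa [add_sub_cancel] at this
  set φ : ℝ → ℝ := fun t => V t * Real.exp (-(2 * c * t)) with hφ
  have hφd : ∀ t, HasDerivAt φ
      ((2 * (P.mulVec (w t) ⬝ᵥ w' t) - 2 * c * V t) * Real.exp (-(2 * c * t))) t := by
    intro t
    have h1 : HasDerivAt (fun t => -(2 * c * t)) (-(2 * c)) t := by
      exact (((hasDerivAt_id t).const_mul (2 * c)).neg).congr_deriv (by ring)
    have h2 := (hVd t).mul h1.exp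
    refine h2.congr_deriv ?_
    ring
  have hanti : AntitoneOn φ (Set.Ici T) := by
    apply antitoneOn_of_deriv_nonpos (convex_Ici T)
      (fun t _ => (hφd t).continuousAt.continuousWithinAt)
      (fun t _ => (hφd t).differentiableAt.differentiableWithinAt)
    intro t ht
    rw [interior_Ici] at ht
    rw [(hφd t).deriv]
    exact mul_nonpos_of_nonpos_of_nonneg (by linarith [hle t (le_of_lt ht)]) (Real.exp_pos _).le
  have hφT : φ T < 0 := mul_neg_of_neg_of_pos hneg (Real.exp_pos _)
  -- lower bound of V
  set b : Fin n → ℝ := fun k => d k * (Real.log (d k + η) - Real.log (d k - η)) with hb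
  have hs : ∀ t, T ≤ t → ∀ k, |(d * w t) k| ≤ b k := by
    intro t ht k
    rcases (hd k).eq_or_lt with h0 | h0
    · simp [hb, ← h0]
    · have h1 := abs_le.mp (bx t ht k)
      have h2 := abs_le.mp (by' t ht k)
      have h3 := hηd k h0
      have l1 := Real.log_le_log (px t k) (show x t k ≤ d k + η by linarith)
      have l2 := Real.log_le_log (py t k) (show y t k ≤ d k + η by linarith)
      have l3 := Real.log_le_log (show 0 < d k - η by linarith) (show d k - η ≤ x t k by linarith)
      have l4 := Real.log_le_log (show 0 < d k - η by linarith) (show d k - η ≤ y t k by linarith)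
      rw [Pi.mul_apply, abs_mul, abs_of_pos h0]
      simp only [hb]
      gcongr
      simp only [hw, Pi.sub_apply, lg]
      rw [abs_le]
      constructor <;> linarith
  have hVlow : ∀ t, T ≤ t → -C * (b ⬝ᵥ b) ≤ V t := by
    intro t ht
    refine le_trans ?_ (hlow (w t))
    have : (d * w t) ⬝ᵥ (d * w t) ≤ b ⬝ᵥ b := by
      refine Finset.sum_le_sum fun k _ => ?_
      have := mul_self_le_mul_self (abs_nonneg _) (hs t ht k)
      rwa [abs_mul_abs_self] at this
    nlinarith
  have htend : Tendsto (fun t => φ T * Real.exp (2 * c * t)) atTop atBot := by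
    apply Tendsto.const_mul_atTop_of_neg hφT
    exact Real.tendsto_exp_atTop.comp (tendsto_id.const_mul_atTop (by positivity))
  obtain ⟨t, ht1, ht2⟩ := ((htend.eventually_lt_atBot (-C * (b ⬝ᵥ b))).and
    (eventually_ge_atTop T)).exists
  have h1 := hanti (Set.mem_Ici.mpr le_rfl) (Set.mem_Ici.mpr ht2) ht2
  have h2 := mul_le_mul_of_nonneg_right h1 (Real.exp_pos (2 * c * t)).le
  have h3 : φ t * Real.exp (2 * c * t) = V t := by
    simp only [hφ]
    rw [mul_assoc, ← Real.exp_add]; simp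
  rw [h3] at h2
  linarith [hVlow t ht2]

theorem lv_equil {n : ℕ} {M : Matrix (Fin n) (Fin n) ℝ} {x : ℝ → Fin n → ℝ} (h : IsLVSol M x)
    {xs : Fin n → ℝ} (hl : Tendsto x atTop (𝓝 xs)) (i : Fin n) :
    xs i * (1 - M.mulVec xs i) = 0 := by
  have hmv : ∀ t : ℝ, ∃ s ∈ Set.Ioo t (t + 1),
      x s i * (1 - M.mulVec (x s) i) = x (t + 1) i - x t i := by
    intro t
    obtain ⟨s, hs, he⟩ := exists_hasDerivAt_eq_slope (fun s => x s i)
      (fun s => x s i * (1 - M.mulVec (x s) i)) (show t < t + 1 by linarith)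
      (fun s _ => (h s i).continuousAt.continuousWithinAt) (fun s _ => h s i)
    refine ⟨s, hs, ?_⟩
    simpa using he
  choose s hs he using hmv
  have hst : Tendsto s atTop atTop := tendsto_atTop_mono (fun t => (hs t).1.le) tendsto_id
  have hxi : Tendsto (fun t => x t i) atTop (𝓝 (xs i)) := (tendsto_pi_nhds.mp hl) i
  have hcont : Continuous fun v : Fin n → ℝ => v i * (1 - M.mulVec v i) := by
    simp only [mulVec, dotProduct]
    fun_prop
  have h1 : Tendsto (fun t => x (s t) i * (1 - M.mulVec (x (s t)) i)) atTop
      (𝓝 (xs i * (1 - M.mulVec xs i))) := (hcont.tendsto xs).comp (hl.comp hst)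
  have h2 : Tendsto (fun t : ℝ => x (t + 1) i - x t i) atTop (𝓝 (xs i - xs i)) :=
    (hxi.comp (tendsto_atTop_add_const_right _ 1 tendsto_id)).sub hxi
  rw [sub_self] at h2
  have h3 : (fun t => x (s t) i * (1 - M.mulVec (x (s t)) i)) = fun t => x (t + 1) i - x t i :=
    funext he
  rw [h3] at h1
  exact tendsto_nhds_unique h1 h2

/-- Initial values of positive solutions bounded by `R` on `[0,T]` and `η`-close to `d`
from time `T` on. -/
def lvPiece {n : ℕ} (M : Matrix (Fin n) (Fin n) ℝ) (d : Fin n → ℝ) (η : ℝ) (T R : ℕ) :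
    Set (Fin n → ℝ) :=
  Set.range (fun p : {x : ℝ → Fin n → ℝ // IsLVSol M x ∧ (∀ t i, 0 < x t i) ∧
    (∀ t ∈ Set.Icc (0 : ℝ) T, ∀ i, x t i ≤ R) ∧ ∀ t, (T : ℝ) ≤ t → ∀ k, |x t k - d k| ≤ η} => p.1 0)

theorem null_piece {n : ℕ} (M : Matrix (Fin n) (Fin n) ℝ) (hM : M.IsSymm)
    (d : Fin n → ℝ) (hd : ∀ k, 0 ≤ d k) (i j : Fin n) (hij : i ≠ j) (hi : 0 < d i) (hj : 0 < d j)
    (hii : M i i = 1) (hjj : M j j = 1) (hMij : 1 < M i j) :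
    ∃ η : ℝ, 0 < η ∧ ∀ T R : ℕ, volume (lvPiece M d η T R) = 0 := by
  obtain ⟨P, c, η, C, e, hc, hη, hηd, he, hP, hC, hlow, hcone⟩ :=
    cone_exists M hM d hd i j hij hi hj hii hjj hMij
  refine ⟨η, hη, fun T R => ?_⟩
  obtain ⟨C', hC'⟩ := pair_lip M T R (Nat.cast_nonneg T) (Nat.cast_nonneg R)
  refine null_of_lip _ (fun p => lg (p.1 T)) C' ?_ ?_
  · rintro ⟨x, hx, px, bx, nx⟩ ⟨y, hy, py, b2, ny⟩
    exact hC' x y hx hy px py bx b2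
  · refine null_of_cone P e he _ ?_
    rintro _ ⟨⟨x, hx, px, bx, nx⟩, rfl⟩ _ ⟨⟨y, hy, py, b2, ny⟩, rfl⟩
    exact pair_cone M d hd P c η C hc hηd hP hC hlow hcone x y hx hy px py T nx ny

theorem lv_limit_is_binary {n : ℕ}
    (A : Matrix (Fin n) (Fin n) ℝ)
    (hAsymm : A.IsSymm) (hA01 : ∀ i j, A i j = 0 ∨ A i j = 1) (hAdiag : ∀ i, A i i = 0)
    (τ : ℝ) (hτ : 1 < τ) :
    ∃ Ω : Set (Fin n → ℝ), volume Ω = 0 ∧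
      ∀ x₀ : Fin n → ℝ, (∀ i, x₀ i ∈ Set.Ioo (0:ℝ) 1) → x₀ ∉ Ω →
        ∀ x : ℝ → Fin n → ℝ, IsLVSol (τ • A + 1) x → x 0 = x₀ →
          ∀ xs : Fin n → ℝ, Tendsto x atTop (𝓝 xs) →
            ∀ i, xs i = 0 ∨ xs i = 1 := by
  set M : Matrix (Fin n) (Fin n) ℝ := τ • A + 1 with hMdef
  have hM : M.IsSymm := by
    unfold Matrix.IsSymm
    simp [hMdef, hAsymm.eq]
  have hMii : ∀ i, M i i = 1 := by
    intro i; simp [hMdef, hAdiag]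
  set E : Set (Fin n → ℝ) :=
    {d | (∀ k, 0 ≤ d k) ∧ ∃ i j, A i j = 1 ∧ 0 < d i ∧ 0 < d j} with hE
  have hpiece : ∀ d ∈ E, ∃ η : ℝ, 0 < η ∧ ∀ T R : ℕ, volume (lvPiece M d η T R) = 0 := by
    rintro d ⟨hd, i, j, hAij, hi, hj⟩
    have hij : i ≠ j := by
      rintro rfl
      rw [hAdiag] at hAij
      exact zero_ne_one hAij
    refine null_piece M hM d hd i j hij hi hj (hMii i) (hMii j) ?_
    simp [hMdef, hAij, Matrix.one_apply_ne hij, hτ]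
  choose! η hη hnull using hpiece
  obtain ⟨D, hDE, hDc, hcov⟩ := TopologicalSpace.countable_cover_nhdsWithin
    (f := fun d => Metric.ball d (η d)) (s := E)
    (fun d hd => nhdsWithin_le_nhds (Metric.ball_mem_nhds d (hη d hd)))
  refine ⟨⋃ d ∈ D, ⋃ T : ℕ, ⋃ R : ℕ, lvPiece M d (η d) T R, ?_, ?_⟩
  · rw [measure_biUnion_null_iff hDc]
    intro d hd
    rw [measure_iUnion_null_iff]
    intro T
    rw [measure_iUnion_null_iff]
    intro R
    exact hnull d (hDE hd) T R
  · intro x₀ hx₀ hΩ x hx hx0 xs hl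
    have px : ∀ t i, 0 < x t i := fun t i => lv_pos hx i (by rw [hx0]; exact (hx₀ i).1) t
    have hxs0 : ∀ k, 0 ≤ xs k := fun k =>
      ge_of_tendsto' ((tendsto_pi_nhds.mp hl) k) (fun t => (px t k).le)
    by_cases hxE : xs ∈ E
    · exfalso
      apply hΩ
      obtain ⟨d, hdD, hball⟩ := Set.mem_iUnion₂.mp (hcov hxE)
      have hev : ∀ᶠ t in atTop, x t ∈ Metric.ball d (η d) :=
        hl (Metric.isOpen_ball.mem_nhds hball)
      obtain ⟨T₀, hT₀⟩ := eventually_atTop.mp hev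
      obtain ⟨T, hT⟩ := exists_nat_ge T₀
      have hcomp : IsCompact (Set.Icc (0 : ℝ) T) := isCompact_Icc
      obtain ⟨B, hB⟩ := (hcomp.image (lv_cont hx)).isBounded.exists_norm_le
      obtain ⟨R, hR⟩ := exists_nat_ge B
      refine Set.mem_iUnion₂.mpr ⟨d, hdD, Set.mem_iUnion.mpr ⟨T, Set.mem_iUnion.mpr ⟨R, ?_⟩⟩⟩
      refine ⟨⟨x, hx, px, ?_, ?_⟩, hx0⟩
      · intro t ht i
        have h1 := hB (x t) ⟨t, ht, rfl⟩
        have h2 := norm_le_pi_norm (x t) i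
        have h3 := le_abs_self (x t i)
        rw [Real.norm_eq_abs] at h2
        linarith
      · intro t ht k
        have h1 := hT₀ t (hT.trans ht)
        rw [Metric.mem_ball, dist_eq_norm] at h1
        exact (norm_le_pi_norm (x t - d) k).trans h1.le
    · intro i
      rcases (hxs0 i).eq_or_lt with h0 | h0
      · exact Or.inl h0.symm
      · right
        have heq := lv_equil hx hl i
        have hz : ∀ j, A i j * xs j = 0 := by
          intro j
          rcases hA01 i j with h | h
          · simp [h]
          · rcases (hxs0 j).eq_or_lt with h2 | h2
            · simp [← h2]
            · exact absurd ⟨hxs0, i, j, h, h0, h2⟩ hxE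
        have hmul : M.mulVec xs i = xs i := by
          have : A.mulVec xs i = 0 := by
            simp only [mulVec, dotProduct, hz, Finset.sum_const_zero]
          simp [hMdef, add_mulVec, smul_mulVec, this]
        rw [hmul] at heq
        rcases mul_eq_zero.mp heq with h | h
        · exact absurd h h0.ne'
        · linarith
end

section
/- Let G be a finite simple undirected graph on n vertices with adjacency matrix A, let τ > 1, and set M = τ·A + I. Let S be a maximal independent set of G and let x* be its indicator vector. Then x* is an asymptotically stable equilibrium of the Lotka–Volterra system: there exists ε > 0 such that every solution x of the LV system defined for all t ≥ 0 with ‖x(0) − x*‖ < ε satisfies lim_{t→∞} x(t) = x*. -/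
open Matrix Filter Topology

/-- `S` is an independent set of the graph with adjacency matrix `A`. -/
def IsIndepSet {n : ℕ} (A : Matrix (Fin n) (Fin n) ℝ) (S : Set (Fin n)) : Prop :=
  ∀ i ∈ S, ∀ j ∈ S, A i j = 0

/-- `S` is a maximal independent set: it is independent and every vertex outside `S`
has a neighbour in `S`. -/
def IsMaxIndepSet {n : ℕ} (A : Matrix (Fin n) (Fin n) ℝ) (S : Set (Fin n)) : Prop :=
  IsIndepSet A S ∧ ∀ i ∉ S, ∃ j ∈ S, A i j = 1

/-- Pointwise Lyapunov estimate. -/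
theorem lv_pointwise {n : ℕ} (A : Matrix (Fin n) (Fin n) ℝ)
    (hA01 : ∀ i j, A i j = 0 ∨ A i j = 1)
    (τ : ℝ) (hτ : 1 < τ) (S : Set (Fin n)) (hS : IsMaxIndepSet A S)
    (e w : Fin n → ℝ) (K δ c : ℝ)
    (heS : ∀ i ∈ S, e i = 1) (heO : ∀ i ∉ S, e i = 0)
    (hwS : ∀ i ∈ S, w i = 1) (hwO : ∀ i ∉ S, w i = K)
    (hK0 : 0 < K) (hK : K * (τ - 1) = (τ - 1) + 8 * n ^ 2 * τ ^ 2)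
    (hδ1 : δ ≤ 1 / 4) (hδ2 : δ * (1 + τ * n) ≤ (τ - 1) / 2)
    (hc1 : c ≤ 1) (hc2 : c ≤ (τ - 1) / 2)
    (x : Fin n → ℝ) (hx : ∀ i, |x i - e i| ≤ δ) :
    ∑ i, w i * (2 * (x i - e i) * (x i * (1 - (τ • A + 1).mulVec x i)))
      ≤ - c * ∑ i, w i * (x i - e i) ^ 2 := by
  classical
  set o : Fin n → ℝ := fun j => if j ∈ S then 0 else 1 with ho
  set Q : ℝ := ∑ j, o j * (x j - e j) ^ 2 with hQ
  have hoS : ∀ i ∈ S, o i = 0 := fun i hi => by simp [ho, hi]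
  have hoO : ∀ i ∉ S, o i = 1 := fun i hi => by simp [ho, hi]
  have hQ0 : 0 ≤ Q := Finset.sum_nonneg fun j _ => by
    by_cases hj : j ∈ S
    · simp [hoS j hj]
    · rw [hoO j hj]; positivity
  have hM : ∀ i, (τ • A + 1).mulVec x i = τ * (∑ j, A i j * x j) + x i := by
    intro i
    rw [Matrix.add_mulVec, Matrix.smul_mulVec, Matrix.one_mulVec]
    simp [Matrix.mulVec, dotProduct]
  set s : Fin n → ℝ := fun j => if j ∈ S then 1 else τ - 1 with hs
  have key : ∀ i, w i * (2 * (x i - e i) * (x i * (1 - (τ • A + 1).mulVec x i)))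
      ≤ 4 * τ ^ 2 * n * Q - w i * s i * (x i - e i) ^ 2 := by
    intro i
    rw [hM i]
    by_cases hi : i ∈ S
    · have hR : (∑ j, A i j * x j) ^ 2 ≤ n * Q := by
        have h1 := sq_sum_le_card_mul_sum_sq (s := (Finset.univ : Finset (Fin n)))
          (f := fun j => A i j * x j)
        simp only [Finset.card_univ, Fintype.card_fin] at h1
        refine h1.trans ?_
        apply mul_le_mul_of_nonneg_left _ (Nat.cast_nonneg n)
        apply Finset.sum_le_sum
        intro j _
        by_cases hj : j ∈ S
        · simp [hS.1 i hi j hj, hoS j hj]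
        · rw [hoO j hj, heO j hj]
          rcases hA01 i j with h | h <;> rw [h]
          · simp; positivity
          · simp
      have hsi : s i = 1 := by simp [hs, hi]
      rw [hwS i hi, hsi]
      have hy := hx i
      rw [heS i hi] at hy ⊢
      set R := ∑ j, A i j * x j
      obtain ⟨y, hyx⟩ : ∃ y, y = x i - 1 := ⟨_, rfl⟩
      have hxi : x i = 1 + y := by rw [hyx]; ring
      rw [← hyx] at hy ⊢
      rw [hxi]
      obtain ⟨ha, hb⟩ := abs_le.1 hy
      have h2 : 4 * τ ^ 2 * R ^ 2 ≤ 4 * τ ^ 2 * n * Q := by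
        have := mul_le_mul_of_nonneg_left hR (by positivity : 0 ≤ 4 * τ ^ 2)
        linarith
      have h3 : 0 ≤ y ^ 2 * (y + 1 / 4) := mul_nonneg (sq_nonneg _) (by linarith)
      have h5 : y * y * (1 + y) ^ 2 ≤ y * y * (25 / 16) :=
        mul_le_mul_of_nonneg_left (by nlinarith) (mul_self_nonneg y)
      have h4 : -(2 * (y * (1 + y)) * (τ * R)) ≤ (1 / 2) * y ^ 2 + 4 * τ ^ 2 * R ^ 2 := by
        nlinarith [sq_nonneg ((y * (1 + y)) / 2 + 2 * (τ * R)), sq_nonneg (τ * R)]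
      nlinarith
    · obtain ⟨j0, hj0, hA0⟩ := hS.2 i hi
      have hδ0 : 0 ≤ δ := (abs_nonneg _).trans (hx i)
      have hR : 1 - n * δ ≤ ∑ j, A i j * x j := by
        have h1 : ∑ j, ((if j = j0 then (1:ℝ) else 0) - δ) = 1 - n * δ := by
          simp [Finset.sum_sub_distrib]
        rw [← h1]
        apply Finset.sum_le_sum
        intro j _
        obtain ⟨ha, hb⟩ := abs_le.1 (hx j)
        by_cases hj : j = j0
        · subst hj
          rw [heS j hj0] at ha
          simp [hA0]; linarith
        · have he : 0 ≤ e j := by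
            by_cases hjS : j ∈ S
            · simp [heS j hjS]
            · simp [heO j hjS]
          rcases hA01 i j with h | h <;> simp [h, hj] <;> linarith
      have hsi : s i = τ - 1 := by simp [hs, hi]
      rw [hwO i hi, hsi]
      have hy := hx i
      rw [heO i hi] at hy ⊢
      rw [sub_zero] at hy ⊢
      obtain ⟨ha, hb⟩ := abs_le.1 hy
      set R := ∑ j, A i j * x j
      have h1 : τ * (1 - n * δ) ≤ τ * R := mul_le_mul_of_nonneg_left hR (by linarith)
      have h2 : 1 - (τ * R + x i) ≤ - ((τ - 1) / 2) := by nlinarith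
      have h3 : K * (2 * x i ^ 2) * (1 - (τ * R + x i)) ≤ K * (2 * x i ^ 2) * (- ((τ - 1) / 2)) :=
        mul_le_mul_of_nonneg_left h2 (by positivity)
      have h4 : 0 ≤ 4 * τ ^ 2 * n * Q := by positivity
      nlinarith
  refine (Finset.sum_le_sum fun i _ => key i).trans ?_
  rw [Finset.sum_sub_distrib, Finset.sum_const, Finset.card_univ, Fintype.card_fin, nsmul_eq_mul,
    hQ, ← mul_assoc, Finset.mul_sum, ← Finset.sum_sub_distrib, Finset.mul_sum]
  apply Finset.sum_le_sum
  intro i _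
  by_cases hi : i ∈ S
  · have hsi : s i = 1 := by simp [hs, hi]
    rw [hoS i hi, hwS i hi, hsi]
    nlinarith [sq_nonneg (x i - e i)]
  · have hsi : s i = τ - 1 := by simp [hs, hi]
    rw [hoO i hi, hwO i hi, hsi]
    have h1 : n * (4 * τ ^ 2 * n) - K * (τ - 1) ≤ - c * K := by nlinarith
    have := mul_le_mul_of_nonneg_right h1 (sq_nonneg (x i - e i))
    linarith

theorem max_indep_indicator_asymptotically_stable {n : ℕ}
    (A : Matrix (Fin n) (Fin n) ℝ)
    (hAsymm : A.IsSymm) (hA01 : ∀ i j, A i j = 0 ∨ A i j = 1) (hAdiag : ∀ i, A i i = 0)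
    (τ : ℝ) (hτ : 1 < τ)
    (S : Set (Fin n)) (hS : IsMaxIndepSet A S) :
    ∃ ε > (0:ℝ), ∀ x : ℝ → Fin n → ℝ, IsLVSol (τ • A + 1) x →
      ‖x 0 - S.indicator (1 : Fin n → ℝ)‖ < ε →
        Tendsto x atTop (𝓝 (S.indicator (1 : Fin n → ℝ))) := by
  classical
  set e : Fin n → ℝ := S.indicator (1 : Fin n → ℝ) with he
  have heS : ∀ i ∈ S, e i = 1 := fun i hi => by simp [he, hi]
  have heO : ∀ i ∉ S, e i = 0 := fun i hi => by simp [he, hi]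
  have hτ1 : 0 < τ - 1 := by linarith
  set K : ℝ := 1 + 8 * n ^ 2 * τ ^ 2 / (τ - 1) with hKd
  have hK1 : 1 ≤ K := by
    have : 0 ≤ 8 * (n:ℝ) ^ 2 * τ ^ 2 / (τ - 1) := by positivity
    linarith
  have hK : K * (τ - 1) = (τ - 1) + 8 * n ^ 2 * τ ^ 2 := by
    rw [hKd]; field_simp
  set w : Fin n → ℝ := fun j => if j ∈ S then 1 else K with hw
  have hwS : ∀ i ∈ S, w i = 1 := fun i hi => by simp [hw, hi]
  have hwO : ∀ i ∉ S, w i = K := fun i hi => by simp [hw, hi]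
  have hw1 : ∀ i, 1 ≤ w i := fun i => by
    by_cases hi : i ∈ S
    · rw [hwS i hi]
    · rw [hwO i hi]; exact hK1
  have hp : 0 < 1 + τ * n := by positivity
  set δ : ℝ := min (1 / 4) ((τ - 1) / 2 / (1 + τ * n)) with hδ
  have hδ0 : 0 < δ := by rw [hδ]; positivity
  have hδ1 : δ ≤ 1 / 4 := min_le_left _ _
  have hδ2 : δ * (1 + τ * n) ≤ (τ - 1) / 2 := (le_div_iff₀ hp).1 (min_le_right _ _)
  set c : ℝ := min 1 ((τ - 1) / 2) with hc
  have hc0 : 0 < c := by rw [hc]; positivity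
  have hc1 : c ≤ 1 := min_le_left _ _
  have hc2 : c ≤ (τ - 1) / 2 := min_le_right _ _
  set V : (Fin n → ℝ) → ℝ := fun x => ∑ i, w i * (x i - e i) ^ 2 with hV
  have hVy : ∀ x i, (x i - e i) ^ 2 ≤ V x := by
    intro x i
    have h1 : w i * (x i - e i) ^ 2 ≤ V x :=
      Finset.single_le_sum (f := fun i => w i * (x i - e i) ^ 2)
        (fun j _ => mul_nonneg (zero_le_one.trans (hw1 j)) (sq_nonneg _)) (Finset.mem_univ i)
    nlinarith [hw1 i, sq_nonneg (x i - e i)]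
  have hVc : Continuous V := by rw [hV]; fun_prop
  have hVe : V e = 0 := by simp [hV]
  have hr : 0 < δ ^ 2 / 2 := by positivity
  obtain ⟨ε, hε, hball⟩ := Metric.continuousAt_iff.1 (hVc.continuousAt (x := e)) _ hr
  refine ⟨ε, hε, fun x hx hx0 => ?_⟩
  have h0 : V (x 0) ≤ δ ^ 2 / 2 := by
    have := hball (x := x 0) (by rw [dist_eq_norm]; exact hx0)
    rw [hVe, Real.dist_eq, sub_zero] at this
    exact (le_abs_self _).trans this.le
  set V' : ℝ → ℝ := fun t =>
    ∑ i, w i * (2 * (x t i - e i) * (x t i * (1 - (τ • A + 1).mulVec (x t) i))) with hV'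
  have hd : ∀ t, HasDerivAt (fun s => V (x s)) (V' t) t := by
    intro t
    apply HasDerivAt.fun_sum
    intro i _
    have := (((hx t i).sub_const (e i)).fun_pow 2).const_mul (w i)
    simpa using this
  have hB : ∀ t, HasDerivAt (fun s => δ ^ 2 / 2 * Real.exp (-(c / 2) * s))
      (-(c / 2) * (δ ^ 2 / 2 * Real.exp (-(c / 2) * t))) t := by
    intro t
    have := (((hasDerivAt_id' t).const_mul (-(c / 2))).exp).const_mul (δ ^ 2 / 2)
    exact this.congr_deriv (by ring)
  have hbound : ∀ t, 0 ≤ t → V (x t) ≤ δ ^ 2 / 2 * Real.exp (-(c / 2) * t) := by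
    intro t ht
    refine image_le_of_deriv_right_lt_deriv_boundary (a := 0) (b := t)
      (f := fun s => V (x s)) (f' := V')
      (fun s _ => (hd s).continuousAt.continuousWithinAt)
      (fun s _ => (hd s).hasDerivWithinAt) (by simpa using h0) hB ?_ ⟨ht, le_rfl⟩
    intro s hs heq
    have hpos : 0 < V (x s) := by rw [heq]; positivity
    have hle : V (x s) ≤ δ ^ 2 / 2 := by
      rw [heq]
      have : Real.exp (-(c / 2) * s) ≤ 1 := Real.exp_le_one_iff.2 (by nlinarith [hs.1])
      nlinarith
    have hp := lv_pointwise A hA01 τ hτ S hS e w K δ c heS heO hwS hwO (by linarith) hK hδ1 hδ2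
      hc1 hc2 (x s) (fun i => abs_le_of_sq_le_sq (by nlinarith [hVy (x s) i]) hδ0.le)
    rw [← heq]
    calc V' s ≤ -c * V (x s) := hp
      _ < _ := by nlinarith
  have hBt : Tendsto (fun t => δ ^ 2 / 2 * Real.exp (-(c / 2) * t)) atTop (𝓝 0) := by
    have h1 : Tendsto (fun t : ℝ => -(c / 2) * t) atTop atBot :=
      tendsto_id.const_mul_atTop_of_neg (by linarith)
    simpa using (Real.tendsto_exp_atBot.comp h1).const_mul (δ ^ 2 / 2)
  rw [tendsto_pi_nhds]
  intro i
  have hsq : Tendsto (fun t => (x t i - e i) ^ 2) atTop (𝓝 0) := by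
    refine tendsto_of_tendsto_of_tendsto_of_le_of_le' tendsto_const_nhds hBt
      (Eventually.of_forall fun t => sq_nonneg _) ?_
    filter_upwards [eventually_ge_atTop 0] with t ht
    exact (hVy (x t) i).trans (hbound t ht)
  have habs : Tendsto (fun t => |x t i - e i|) atTop (𝓝 0) := by
    have := hsq.sqrt
    simpa [Real.sqrt_sq_eq_abs] using this
  have := (tendsto_zero_iff_abs_tendsto_zero _).2 habs
  exact tendsto_sub_nhds_zero_iff.1 this
end

section
/- Let G be a finite simple undirected graph on n vertices with adjacency matrix A having at least one edge, let τ > 1, and set M = τ·A + I. Suppose x* ∈ ℝⁿ satisfies 0 < x*_i < 1 for all i and M·x* = 𝟙 (so x* is an interior equilibrium of the Lotka–Volterra system). Then the matrix J(x*) = −diag(x*)·M has a positive real eigenvalue; equivalently, the real symmetric matrix C = −diag(x*)^{1/2}·M·diag(x*)^{1/2} is not negative semidefinite, i.e., there exists v ∈ ℝⁿ with vᵀ·C·v > 0. -/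
open Matrix

theorem interior_equilibrium_unstable {n : ℕ}
    (A : Matrix (Fin n) (Fin n) ℝ)
    (hAsymm : A.IsSymm) (hA01 : ∀ i j, A i j = 0 ∨ A i j = 1) (hAdiag : ∀ i, A i i = 0)
    (hedge : ∃ i j, A i j = 1)
    (τ : ℝ) (hτ : 1 < τ)
    (xstar : Fin n → ℝ) (hx : ∀ i, 0 < xstar i ∧ xstar i < 1)
    (heq : (τ • A + 1).mulVec xstar = fun _ => 1) :
    (∃ μ : ℝ, 0 < μ ∧ ∃ v : Fin n → ℝ, v ≠ 0 ∧
        (-(Matrix.diagonal xstar * (τ • A + 1))).mulVec v = μ • v) ∧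
      (∃ v : Fin n → ℝ, 0 < v ⬝ᵥ
        ((-(Matrix.diagonal (fun i => Real.sqrt (xstar i)) * (τ • A + 1) *
            Matrix.diagonal (fun i => Real.sqrt (xstar i)))).mulVec v)) := by
  have hd : ∀ i, 0 < Real.sqrt (xstar i) := fun i => Real.sqrt_pos.mpr (hx i).1
  have hdd : ∀ i, Real.sqrt (xstar i) * Real.sqrt (xstar i) = xstar i :=
    fun i => Real.mul_self_sqrt (hx i).1.le
  set d : Fin n → ℝ := fun i => Real.sqrt (xstar i) with hdef
  set M : Matrix (Fin n) (Fin n) ℝ := τ • A + 1 with hM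
  have hMs : Mᵀ = M := by
    rw [hM, transpose_add, transpose_smul, hAsymm.eq, transpose_one]
  have hDD : diagonal xstar = diagonal d * diagonal d := by
    rw [diagonal_mul_diagonal]
    congr 1
    funext i
    exact (hdd i).symm
  have h2 : ∃ v : Fin n → ℝ, 0 < v ⬝ᵥ ((-(diagonal d * M * diagonal d)).mulVec v) := by
    obtain ⟨i, j, hij⟩ := hedge
    have hne : i ≠ j := by
      rintro rfl
      rw [hAdiag] at hij
      exact zero_ne_one hij
    have hji : A j i = 1 := by rw [← hij]; exact hAsymm.apply i j
    let w : Fin n → ℝ := Pi.single i 1 - Pi.single j 1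
    have hw : w ⬝ᵥ (M *ᵥ w) = 2 - 2 * τ := by
      simp only [w, mulVec_sub, sub_dotProduct, dotProduct_sub, single_one_dotProduct,
        mulVec_single_one, Matrix.col_apply]
      simp [hM, hAdiag, hij, hji, hne, hne.symm]
      ring
    have hv : diagonal d *ᵥ (fun k => w k / d k) = w := by
      funext k
      rw [mulVec_diagonal]
      exact mul_div_cancel₀ _ (hd k).ne'
    refine ⟨fun k => w k / d k, ?_⟩
    have hv' : (fun k => w k / d k) ᵥ* diagonal d = w := by
      funext k
      rw [vecMul_diagonal]
      exact div_mul_cancel₀ _ (hd k).ne'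
    rw [neg_mulVec, dotProduct_neg, ← mulVec_mulVec, ← mulVec_mulVec, hv,
      dotProduct_mulVec, hv', hw]
    linarith
  refine ⟨?_, h2⟩
  set C : Matrix (Fin n) (Fin n) ℝ := -(diagonal d * M * diagonal d) with hC
  have hCH : C.IsHermitian := by
    rw [Matrix.IsHermitian, conjTranspose_eq_transpose_of_trivial, hC, transpose_neg,
      transpose_mul, transpose_mul, hMs, diagonal_transpose, Matrix.mul_assoc]
  have hnH : (-C).IsHermitian := hCH.neg
  obtain ⟨k, hk⟩ : ∃ k, hnH.eigenvalues k < 0 := by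
    by_contra! hcon
    have hps : (-C).PosSemidef := hnH.posSemidef_iff_eigenvalues_nonneg.mpr hcon
    obtain ⟨v, hv⟩ := h2
    have := hps.dotProduct_mulVec_nonneg v
    rw [neg_mulVec, dotProduct_neg, star_trivial] at this
    linarith
  have hev := hnH.mulVec_eigenvectorBasis k
  have hne0 := hnH.eigenvectorBasis.orthonormal.ne_zero k
  set u : Fin n → ℝ := (hnH.eigenvectorBasis k).ofLp with hu
  have hu0 : u ≠ 0 := by
    intro h
    apply hne0
    ext i
    exact congrFun h i
  have hCu : C *ᵥ u = (-hnH.eigenvalues k) • u := by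
    rw [neg_mulVec] at hev
    rw [neg_smul, ← hev, neg_neg]
  refine ⟨-hnH.eigenvalues k, by linarith, diagonal d *ᵥ u, ?_, ?_⟩
  · intro h
    apply hu0
    funext i
    have := congrFun h i
    rw [mulVec_diagonal] at this
    exact (mul_eq_zero.mp this).resolve_left (hd i).ne'
  · rw [← mulVec_smul, ← hCu, mulVec_mulVec, mulVec_mulVec, hDD, hC]
    congr 1
    simp only [Matrix.mul_assoc, Matrix.neg_mul, Matrix.mul_neg]
end

section
/- Let G be a finite simple undirected graph on n vertices with adjacency matrix A, let τ > 1, and set M = τ·A + I. Let S be a maximal independent set of G, let x* be its indicator vector, and let J(x*) be the Jacobian of the Lotka–Volterra vector field at x*, i.e., J(x*)_{ij} = δ_{ij}·(1 − (M·x*)_i) − x*_i·M_{ij}. Then every eigenvalue of J(x*) is real and strictly negative. -/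
open Matrix

/-- The Jacobian of the Lotka–Volterra vector field at the point `x`:
`J(x)_{ij} = δ_{ij}·(1 − (M·x)_i) − x_i·M_{ij}`. -/
def lvJacobian {n : ℕ} (M : Matrix (Fin n) (Fin n) ℝ) (x : Fin n → ℝ) :
    Matrix (Fin n) (Fin n) ℝ :=
  Matrix.of fun i j => (if i = j then 1 - M.mulVec x i else 0) - x i * M i j

theorem jacobian_at_max_indep_negative_eigenvalues {n : ℕ}
    (A : Matrix (Fin n) (Fin n) ℝ)
    (hAsymm : A.IsSymm) (hA01 : ∀ i j, A i j = 0 ∨ A i j = 1) (hAdiag : ∀ i, A i i = 0)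
    (τ : ℝ) (hτ : 1 < τ)
    (S : Set (Fin n)) (hS : IsMaxIndepSet A S) :
    ∀ μ : ℂ, (∃ v : Fin n → ℂ, v ≠ 0 ∧
        ((lvJacobian (τ • A + 1) (S.indicator (1 : Fin n → ℝ))).map
          (Complex.ofReal)).mulVec v = μ • v) →
      μ.im = 0 ∧ μ.re < 0 := by
  classical
  obtain ⟨hI, hmax⟩ := hS
  rintro μ ⟨v, hv, hJ⟩
  set x : Fin n → ℝ := S.indicator (1 : Fin n → ℝ) with hx
  set M : Matrix (Fin n) (Fin n) ℝ := τ • A + 1 with hM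
  have hx1 : ∀ i ∈ S, x i = 1 := fun i hi => by simp [hx, hi]
  have hx0 : ∀ i, i ∉ S → x i = 0 := fun i hi => by simp [hx, hi]
  have hMij : ∀ i j, M i j = τ * A i j + (if i = j then 1 else 0) := fun i j => by
    simp [hM, Matrix.one_apply]
  have hrow : ∀ i, ∑ j, ((lvJacobian M x i j : ℝ) : ℂ) * v j = μ * v i := fun i => by
    have := congrFun hJ i
    simpa [Matrix.mulVec, dotProduct] using this
  by_cases h : ∃ i, i ∉ S ∧ v i ≠ 0
  · obtain ⟨i, hi, hvi⟩ := h
    have h1 := hrow i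
    have h2 : ∀ j, ((lvJacobian M x i j : ℝ) : ℂ) * v j
        = if i = j then (((1 - M.mulVec x i : ℝ)) : ℂ) * v j else 0 := fun j => by
      by_cases hij : i = j
      · simp only [lvJacobian, Matrix.of_apply, hx0 i hi, zero_mul, sub_zero, if_pos hij]
      · simp only [lvJacobian, Matrix.of_apply, hx0 i hi, zero_mul, sub_zero, if_neg hij,
          Complex.ofReal_zero]
    rw [Finset.sum_congr rfl (fun j _ => h2 j), Finset.sum_ite_eq] at h1
    simp only [Finset.mem_univ, if_true] at h1
    have h3 := mul_right_cancel₀ hvi h1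
    obtain ⟨k, hk, hik⟩ := hmax i hi
    have h4 : M i k * x k ≤ M.mulVec x i := by
      refine Finset.single_le_sum (f := fun j => M i j * x j) ?_ (Finset.mem_univ k)
      intro j _
      refine mul_nonneg ?_ ?_
      · rw [hMij]
        rcases hA01 i j with h | h <;> rw [h] <;> split_ifs <;> linarith
      · by_cases hj : j ∈ S
        · rw [hx1 j hj]; exact zero_le_one
        · rw [hx0 j hj]
    have hne : i ≠ k := fun h => hi (h ▸ hk)
    rw [hMij, hx1 k hk, hik, if_neg hne] at h4
    rw [← h3]
    refine ⟨Complex.ofReal_im _, ?_⟩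
    rw [Complex.ofReal_re]
    linarith
  · push Not at h
    obtain ⟨i, hvi⟩ := Function.ne_iff.mp hv
    have hi : i ∈ S := by
      by_contra hi
      exact hvi (h i hi)
    have hMx : M.mulVec x i = 1 := by
      have : ∀ j, M i j * x j = if i = j then 1 else 0 := fun j => by
        by_cases hj : j ∈ S
        · rw [hMij, hx1 j hj, hI i hi j hj]; simp
        · have hne : i ≠ j := fun h => hj (h ▸ hi)
          rw [hx0 j hj, if_neg hne, mul_zero]
      simp [Matrix.mulVec, dotProduct, this]
    have h1 := hrow i
    have h2 : ∀ j, ((lvJacobian M x i j : ℝ) : ℂ) * v j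
        = if i = j then (-1 : ℂ) * v j else 0 := fun j => by
      by_cases hj : j ∈ S
      · by_cases hij : i = j
        · subst hij
          simp [lvJacobian, hMx, hMij, hx1 i hi, hAdiag]
        · simp [lvJacobian, hMij, hI i hi j hj, hij]
      · simp [h j hj]
    rw [Finset.sum_congr rfl (fun j _ => h2 j), Finset.sum_ite_eq] at h1
    simp only [Finset.mem_univ, if_true] at h1
    have h3 := mul_right_cancel₀ hvi h1
    rw [← h3]
    simp
end

section
/- Let G be a finite simple undirected graph on n vertices with adjacency matrix A, let τ > 0, and set M = τ·A + I. Let S ⊆ {1,…,n} be an independent set of G that is not maximal, let x* be its indicator vector, and let J(x*) be the Jacobian of the Lotka–Volterra vector field at x*. Then 1 is an eigenvalue of J(x*); in particular J(x*) has a positive eigenvalue. -/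
open Matrix

theorem jacobian_at_nonmaximal_indep_has_eigenvalue_one {n : ℕ}
    (A : Matrix (Fin n) (Fin n) ℝ)
    (hAsymm : A.IsSymm) (hA01 : ∀ i j, A i j = 0 ∨ A i j = 1) (hAdiag : ∀ i, A i i = 0)
    (τ : ℝ) (hτ : 0 < τ)
    (S : Set (Fin n)) (hS : IsIndepSet A S) (hSnotmax : ¬ IsMaxIndepSet A S) :
    (∃ v : Fin n → ℝ, v ≠ 0 ∧
        (lvJacobian (τ • A + 1) (S.indicator (1 : Fin n → ℝ))).mulVec v = (1:ℝ) • v) ∧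
      (∃ μ : ℝ, 0 < μ ∧ ∃ v : Fin n → ℝ, v ≠ 0 ∧
        (lvJacobian (τ • A + 1) (S.indicator (1 : Fin n → ℝ))).mulVec v = μ • v) := by
  have key : ∃ v : Fin n → ℝ, v ≠ 0 ∧
      (lvJacobian (τ • A + 1) (S.indicator (1 : Fin n → ℝ))).mulVec v = (1:ℝ) • v := by
    have h : ∃ k, k ∉ S ∧ ∀ j ∈ S, A k j = 0 := by
      by_contra hc
      apply hSnotmax
      refine ⟨hS, fun i hi => ?_⟩
      by_contra hn
      refine hc ⟨i, hi, fun j hj => ?_⟩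
      rcases hA01 i j with h0 | h1
      · exact h0
      · exact absurd ⟨j, hj, h1⟩ hn
    obtain ⟨k, hk, hkS⟩ := h
    refine ⟨Pi.single k 1, ?_, ?_⟩
    · intro h0
      have := congrFun h0 k
      simp at this
    · have hMx : (τ • A + 1 : Matrix (Fin n) (Fin n) ℝ).mulVec
          (S.indicator (1 : Fin n → ℝ)) k = 0 := by
        unfold Matrix.mulVec dotProduct
        refine Finset.sum_eq_zero fun j _ => ?_
        by_cases hj : j ∈ S
        · have hne : k ≠ j := fun e => hk (e ▸ hj)
          simp [hkS j hj, Matrix.one_apply_ne hne]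
        · simp [hj]
      funext i
      rw [Matrix.mulVec_single_one]
      simp only [Matrix.col_apply, lvJacobian, Matrix.of_apply, one_smul]
      by_cases hik : i = k
      · subst hik
        rw [if_pos rfl, hMx]
        simp [hk]
      · rw [if_neg hik, Pi.single_eq_of_ne hik]
        by_cases hi : i ∈ S
        · have : A i k = 0 := by rw [← hAsymm.apply i k]; exact hkS i hi
          simp [this, Matrix.one_apply_ne hik]
        · simp [hi]
  exact ⟨key, 1, one_pos, key⟩
end

section
/- Let A be the adjacency matrix of the complete graph on n ≥ 2 vertices, let τ ≥ 0, set M = τ·A + I, and let x* be the constant vector with all entries equal to (τ(n−1)+1)^{-1} (the interior equilibrium, satisfying M·x* = 𝟙). Then every eigenvalue of J(x*) = −diag(x*)·M is negative if and only if τ < 1. Equivalently, the symmetric matrix diag(x*)·M is positive definite if and only if τ < 1. -/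
open Matrix

theorem complete_graph_interior_equilibrium_stability {n : ℕ} (hn : 2 ≤ n)
    (τ : ℝ) (hτ : 0 ≤ τ) :
    let A : Matrix (Fin n) (Fin n) ℝ := Matrix.of fun i j => if i = j then 0 else 1
    let xstar : Fin n → ℝ := fun _ => (τ * ((n:ℝ) - 1) + 1)⁻¹
    ((∀ μ : ℝ, (∃ v : Fin n → ℝ, v ≠ 0 ∧
        (-(Matrix.diagonal xstar * (τ • A + 1))).mulVec v = μ • v) → μ < 0) ↔ τ < 1) ∧
      ((Matrix.diagonal xstar * (τ • A + 1)).PosDef ↔ τ < 1) := by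
  intro A xstar
  have hn' : (2:ℝ) ≤ n := by exact_mod_cast hn
  obtain ⟨c, hc⟩ : ∃ c : ℝ, c = (τ * ((n:ℝ) - 1) + 1)⁻¹ := ⟨_, rfl⟩
  have hc0 : 0 < c := by
    rw [hc]
    have : 0 ≤ τ * ((n:ℝ) - 1) := mul_nonneg hτ (by linarith)
    positivity
  obtain ⟨B, hBdef⟩ : ∃ B, B = Matrix.diagonal xstar * (τ • A + 1) := ⟨_, rfl⟩
  have hBij : ∀ i j, B i j = c * (τ + (1 - τ) * (if i = j then 1 else 0)) := by
    intro i j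
    rw [hBdef, Matrix.diagonal_mul]
    simp only [xstar, ← hc, A, Matrix.add_apply, Matrix.smul_apply, Matrix.of_apply,
      Matrix.one_apply, smul_eq_mul]
    split_ifs <;> ring
  have hB : ∀ (v : Fin n → ℝ) i, (B *ᵥ v) i = c * (τ * ∑ j, v j + (1 - τ) * v i) := by
    intro v i
    simp only [Matrix.mulVec, dotProduct, hBij]
    have : ∀ j, c * (τ + (1 - τ) * (if i = j then 1 else 0)) * v j
        = c * τ * v j + (if i = j then c * (1 - τ) * v j else 0) := by
      intro j
      split_ifs <;> ring
    simp only [this, Finset.sum_add_distrib, ← Finset.mul_sum, Finset.sum_ite_eq,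
      Finset.mem_univ, if_true]
    ring
  have hQ : ∀ v : Fin n → ℝ, v ⬝ᵥ (B *ᵥ v)
      = c * (τ * (∑ j, v j) ^ 2 + (1 - τ) * (v ⬝ᵥ v)) := by
    intro v
    simp only [dotProduct, hB]
    have : ∀ i, v i * (c * (τ * ∑ j, v j + (1 - τ) * v i))
        = (c * τ * ∑ j, v j) * v i + c * (1 - τ) * (v i * v i) := by
      intro i; ring
    simp only [this, Finset.sum_add_distrib, ← Finset.mul_sum]
    ring
  have hpos : ∀ v : Fin n → ℝ, v ≠ 0 → 0 < v ⬝ᵥ v := by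
    intro v hv
    have h0 : 0 ≤ v ⬝ᵥ v := Finset.sum_nonneg fun i _ => mul_self_nonneg (v i)
    exact lt_of_le_of_ne h0 fun h => hv (dotProduct_self_eq_zero.1 h.symm)
  rw [← hBdef]
  have P1 : τ < 1 → B.PosDef := by
    intro h
    refine Matrix.PosDef.of_dotProduct_mulVec_pos ?_ ?_
    · ext i j
      simp [Matrix.conjTranspose_apply, hBij, eq_comm]
    · intro v hv
      rw [star_trivial, hQ]
      have h1 := mul_pos (sub_pos.2 h) (hpos v hv)
      have h2 := mul_nonneg hτ (sq_nonneg (∑ j, v j))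
      exact mul_pos hc0 (by linarith)
  have P2 : B.PosDef → ∀ μ : ℝ, (∃ v : Fin n → ℝ, v ≠ 0 ∧ (-B).mulVec v = μ • v) → μ < 0 := by
    rintro h μ ⟨v, hv, hvμ⟩
    have h1 := h.dotProduct_mulVec_pos hv
    rw [star_trivial] at h1
    have h2 : B *ᵥ v = -(μ • v) := by rw [← hvμ, Matrix.neg_mulVec, neg_neg]
    rw [h2, dotProduct_neg, dotProduct_smul, smul_eq_mul] at h1
    have := hpos v hv
    by_contra! hμ
    nlinarith [mul_nonneg hμ this.le]
  have P3 : (∀ μ : ℝ, (∃ v : Fin n → ℝ, v ≠ 0 ∧ (-B).mulVec v = μ • v) → μ < 0) → τ < 1 := by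
    intro h
    let a : Fin n := ⟨0, by omega⟩
    let b : Fin n := ⟨1, by omega⟩
    have hab : a ≠ b := by simp [a, b]
    have h1 := h (-(c * (1 - τ))) ⟨Pi.single a 1 - Pi.single b 1, ?_, ?_⟩
    · have : 0 < c * (1 - τ) := by linarith
      have := (mul_pos_iff_of_pos_left hc0).1 this
      linarith
    · intro h0
      have := congrFun h0 a
      simp [hab] at this
    · ext i
      rw [Matrix.neg_mulVec, Pi.neg_apply, hB]
      have : ∑ j, (Pi.single a 1 - Pi.single b 1 : Fin n → ℝ) j = 0 := by
        simp [Finset.sum_sub_distrib]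
      rw [this, Pi.smul_apply, smul_eq_mul]
      ring
  exact ⟨⟨P3, fun h => P2 (P1 h)⟩, ⟨fun h => P3 (P2 h), P1⟩⟩
end

section
/- Let n ≥ 4 be even, let A be the adjacency matrix of the path graph P_n, and set τ* = (2·cos(π/(n−1)))^{-1}. Then det(τ*·A + I) = −2^{1−n} · (cos(π/(n−1)))^{1−n}; in particular det(τ*·A + I) < 0. -/
open Matrix Real

/-- Adjacency matrix of the path graph `P_n` on vertices `0, …, n−1` (consecutive
vertices adjacent). -/
def pathAdj (n : ℕ) : Matrix (Fin n) (Fin n) ℝ :=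
  Matrix.of fun i j => if (i:ℕ) + 1 = (j:ℕ) ∨ (j:ℕ) + 1 = (i:ℕ) then 1 else 0

lemma pathAdj_det_rec (t : ℝ) (n : ℕ) :
    (t • pathAdj (n + 2) + 1).det
      = (t • pathAdj (n + 1) + 1).det - t ^ 2 * (t • pathAdj n + 1).det := by
  have h1 : (t • pathAdj (n + 2) + 1).submatrix Fin.succ (Fin.succAbove 0)
      = t • pathAdj (n + 1) + 1 := by
    ext i j
    simp [pathAdj, Matrix.one_apply]
  have h2 : ((t • pathAdj (n + 2) + 1).submatrix Fin.succ (Fin.succAbove 1)).det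
      = t * (t • pathAdj n + 1).det := by
    rw [det_succ_column_zero, Fin.sum_univ_succ, Finset.sum_eq_zero]
    · have h3 : (((t • pathAdj (n + 2) + 1).submatrix Fin.succ (Fin.succAbove 1)).submatrix
          (Fin.succAbove 0) Fin.succ) = t • pathAdj n + 1 := by
        ext i j
        have : (Fin.succAbove (1 : Fin (n + 2)) j.succ) = j.succ.succ := by
          rw [← Fin.succ_zero_eq_one, Fin.succ_succAbove_succ]; simp
        simp [pathAdj, Matrix.one_apply, this]
      rw [h3]
      simp [pathAdj, Matrix.one_apply]
    · intro i _
      simp [pathAdj, Matrix.one_apply, Fin.ext_iff]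
  rw [det_succ_row_zero, Fin.sum_univ_succ, Fin.sum_univ_succ, Finset.sum_eq_zero, h1]
  · simp only [Fin.succ_zero_eq_one]
    rw [h2]
    simp [pathAdj, Matrix.one_apply]
    ring
  · intro i _
    have h0 : (t • pathAdj (n + 2) + 1) 0 i.succ.succ = 0 := by
      have hne : (0 : Fin (n + 2)) ≠ i.succ.succ := (Fin.succ_ne_zero _).symm
      rw [Matrix.add_apply, Matrix.one_apply_ne hne]
      simp [pathAdj]
    rw [h0]
    ring

lemma pathAdj_det_sin (x : ℝ) (hx : cos x ≠ 0) (n : ℕ) :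
    (2 * cos x) ^ n * sin x * ((2 * cos x)⁻¹ • pathAdj n + 1).det = sin ((n + 1) * x) := by
  induction n using Nat.twoStepInduction with
  | zero => simp
  | one =>
    have : (((1 : ℕ) : ℝ) + 1) * x = 2 * x := by push_cast; ring
    rw [this, sin_two_mul]
    simp [pathAdj]
    ring
  | more n ih1 ih2 =>
    rw [pathAdj_det_rec]
    have e1 : (((n + 2 : ℕ) : ℝ) + 1) * x = (((n + 1 : ℕ) : ℝ) + 1) * x + x := by
      push_cast; ring
    have e2 : ((n : ℝ) + 1) * x = (((n + 1 : ℕ) : ℝ) + 1) * x - x := by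
      push_cast; ring
    have key : sin ((((n + 2 : ℕ) : ℝ) + 1) * x)
        = 2 * cos x * sin ((((n + 1 : ℕ) : ℝ) + 1) * x) - sin (((n : ℝ) + 1) * x) := by
      rw [e1, e2, sin_add, sin_sub]; ring
    rw [key, ← ih1, ← ih2]
    have hc : (2 * cos x) * (2 * cos x)⁻¹ = 1 := mul_inv_cancel₀ (by positivity)
    generalize (2 * cos x)⁻¹ = t at *
    generalize 2 * cos x = c at *
    have : c ^ 2 * t ^ 2 = 1 := by rw [← mul_pow, hc, one_pow]
    linear_combination (-(c ^ n * sin x * (t • pathAdj n + 1).det)) * this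

theorem det_path_graph_at_critical_tau {n : ℕ} (hn : 4 ≤ n) (hneven : Even n) :
    ((2 * Real.cos (Real.pi / ((n:ℝ) - 1)))⁻¹ • pathAdj n + 1).det =
        -(2:ℝ) ^ ((1:ℤ) - (n:ℤ)) * (Real.cos (Real.pi / ((n:ℝ) - 1))) ^ ((1:ℤ) - (n:ℤ)) ∧
      ((2 * Real.cos (Real.pi / ((n:ℝ) - 1)))⁻¹ • pathAdj n + 1).det < 0 := by
  have hn' : (4 : ℝ) ≤ n := by exact_mod_cast hn
  have hpi := Real.pi_pos
  have hd : (0 : ℝ) < (n : ℝ) - 1 := by linarith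
  have hs : ((n : ℝ) + 1) * (π / ((n : ℝ) - 1)) = 2 * (π / ((n : ℝ) - 1)) + π := by
    field_simp; ring
  have hx0 : 0 < π / ((n : ℝ) - 1) := by positivity
  have hx1 : π / ((n : ℝ) - 1) < π / 2 :=
    div_lt_div_of_pos_left hpi (by norm_num) (by linarith)
  generalize π / ((n : ℝ) - 1) = x at *
  have hc : 0 < cos x := cos_pos_of_mem_Ioo ⟨by linarith, hx1⟩
  have hsin : 0 < sin x := sin_pos_of_pos_of_lt_pi hx0 (by linarith)
  have h := pathAdj_det_sin x hc.ne' n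
  rw [hs, sin_add_pi, sin_two_mul] at h
  have main : ((2 * cos x)⁻¹ • pathAdj n + 1).det
      = -(2:ℝ) ^ ((1:ℤ) - (n:ℤ)) * (cos x) ^ ((1:ℤ) - (n:ℤ)) := by
    rw [neg_mul, ← mul_zpow, zpow_sub₀ (by positivity), zpow_one, zpow_natCast]
    have hp : (2 * cos x) ^ n ≠ 0 := by positivity
    rw [← neg_div, eq_div_iff hp]
    apply mul_left_cancel₀ hsin.ne'
    linear_combination h
  refine ⟨main, ?_⟩
  rw [main, neg_mul, neg_lt_zero]
  positivity
end
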